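/- arXiv:2102.02195 — 4 statements merged into one kernel-verified Lean document; each statement's English description precedes it below -/
import Mathlib

section
/- For a generic endomorphism f of ℂⁿ (n ≥ 1), every periodic point of f is hyperbolic. That is, the set of f ∈ End(ℂⁿ) all of whose periodic points are hyperbolic is residual in End(ℂⁿ). (This is Theorem 1.1(a) of the paper, proved there for all Oka-Stein manifolds; ℂⁿ is the basic example of an Oka-Stein manifold.) -/
open Function Topology Filter Metric

noncomputable section

/-- `ℂⁿ` as a Euclidean space. -/
abbrev Cn (n : ℕ) := EuclideanSpace ℂ (Fin n)

/-- The space `End(ℂⁿ)` of holomorphic self-maps of `ℂⁿ`, topologized as a subspace of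
the continuous maps `C(ℂⁿ, ℂⁿ)` with the compact-open topology. -/
abbrev Endo (n : ℕ) := {f : C(Cn n, Cn n) // Differentiable ℂ ⇑f}

variable {n : ℕ}

/-- The underlying function of an endomorphism. -/
def eapp (f : Endo n) : Cn n → Cn n := ⇑f.1

/-- `p` is a periodic point of `f`. -/
def IsPer (f : Endo n) (p : Cn n) : Prop := ∃ m, 1 ≤ m ∧ (eapp f)^[m] p = p

/-- The minimal period of a periodic point. -/
def minPer (f : Endo n) (p : Cn n) : ℕ := Function.minimalPeriod (eapp f) p

/-- The eigenvalues at a periodic point `p`: the spectrum of the derivative of the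
`minPer f p`-th iterate at `p`. -/
def eigs (f : Endo n) (p : Cn n) : Set ℂ := spectrum ℂ (fderiv ℂ ((eapp f)^[minPer f p]) p)

/-- Hyperbolic periodic point: no eigenvalue of absolute value 1. -/
def IsHypPer (f : Endo n) (p : Cn n) : Prop := IsPer f p ∧ ∀ z ∈ eigs f p, ‖z‖ ≠ 1

/-- Attracting periodic point: all eigenvalues of absolute value < 1. -/
def IsAttPer (f : Endo n) (p : Cn n) : Prop := IsPer f p ∧ ∀ z ∈ eigs f p, ‖z‖ < 1

/-- Repelling periodic point: all eigenvalues of absolute value > 1. -/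
def IsRepPer (f : Endo n) (p : Cn n) : Prop := IsPer f p ∧ ∀ z ∈ eigs f p, 1 < ‖z‖

/-- Saddle periodic point: hyperbolic with eigenvalues of absolute value both < 1 and > 1. -/
def IsSadPer (f : Endo n) (p : Cn n) : Prop :=
  IsHypPer f p ∧ (∃ z ∈ eigs f p, ‖z‖ < 1) ∧ (∃ z ∈ eigs f p, 1 < ‖z‖)

/-- Super-attracting periodic point: the derivative of the `minPer`-th iterate vanishes. -/
def IsSuperAttPer (f : Endo n) (p : Cn n) : Prop :=
  IsPer f p ∧ fderiv ℂ ((eapp f)^[minPer f p]) p = 0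

/-- The set of attracting periodic points of `f`. -/
def attSet (f : Endo n) : Set (Cn n) := {p | IsAttPer f p}

/-- The set of repelling periodic points of `f`. -/
def repSet (f : Endo n) : Set (Cn n) := {p | IsRepPer f p}

/-- The set of saddle periodic points of `f`. -/
def sadSet (f : Endo n) : Set (Cn n) := {p | IsSadPer f p}

/-- The robustly non-expelling set of `f`. -/
def rne (f : Endo n) : Set (Cn n) :=
  {p | ∃ U : Set (Cn n), IsOpen U ∧ p ∈ U ∧ ∃ V ∈ 𝓝 f, ∃ K : Set (Cn n),
        IsCompact K ∧ ∀ g ∈ V, ∀ j : ℕ, (eapp g)^[j] '' U ⊆ K}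

/-- A sequence of maps diverges locally uniformly to infinity on `U`. -/
def DivLocUnifOn (F : ℕ → Cn n → Cn n) (U : Set (Cn n)) : Prop :=
  ∀ L ⊆ U, IsCompact L → ∀ K : Set (Cn n), IsCompact K →
    ∀ᶠ j in atTop, Disjoint (F j '' L) K

/-- `p` belongs to the Fatou set of `f`: the iterates form a normal family near `p`. -/
def FatouAt (f : Endo n) (p : Cn n) : Prop :=
  ∃ U : Set (Cn n), IsOpen U ∧ p ∈ U ∧
    ∀ k : ℕ → ℕ, StrictMono k → ∃ l : ℕ → ℕ, StrictMono l ∧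
      ((∃ g : Cn n → Cn n, DifferentiableOn ℂ g U ∧
          TendstoLocallyUniformlyOn (fun j => (eapp f)^[k (l j)]) g atTop U) ∨
        DivLocUnifOn (fun j => (eapp f)^[k (l j)]) U)

/-- The Fatou set of `f`. -/
def Fatou (f : Endo n) : Set (Cn n) := {p | FatouAt f p}

/-- The Julia set of `f`. -/
def Julia (f : Endo n) : Set (Cn n) := (Fatou f)ᶜ

/-- The cycle (finite orbit) of a periodic point `p`. -/
def cycleOf (f : Endo n) (p : Cn n) : Set (Cn n) := {x | ∃ i < minPer f p, (eapp f)^[i] p = x}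

/-- The basin of attraction of the cycle of `p`. -/
def basinOf (f : Endo n) (p : Cn n) : Set (Cn n) :=
  {x | ∃ a ∈ cycleOf f p, Tendsto (fun k => (eapp f)^[minPer f p * k] x) atTop (𝓝 a)}

/-- The non-wandering set of `f`. -/
def nonWandering (f : Endo n) : Set (Cn n) :=
  {p | ∀ U ∈ 𝓝 p, ∃ k, 1 ≤ k ∧ (U ∩ (eapp f)^[k] '' U).Nonempty}

/-- The set of points whose orbit can be closed in the weak sense. -/
def cloSet (f : Endo n) : Set (Cn n) :=
  {p | ∀ U ∈ 𝓝 p, ∀ V ∈ 𝓝 f, ∃ g ∈ V, ∃ q ∈ U, IsPer g q}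

/-- `𝒯(m,K)`: endomorphisms all of whose periodic points in `K` of minimal period at most `m`
are transverse. -/
def TransSet (n : ℕ) (m : ℕ) (K : Set (Cn n)) : Set (Endo n) :=
  {f | ∀ p ∈ K, IsPer f p → minPer f p ≤ m → (1 : ℂ) ∉ eigs f p}

/-- `ℋ(m,K)`: endomorphisms all of whose periodic points in `K` of minimal period at most `m`
are hyperbolic. -/
def HypSet (n : ℕ) (m : ℕ) (K : Set (Cn n)) : Set (Endo n) :=
  {f | ∀ p ∈ K, IsPer f p → minPer f p ≤ m → ∀ z ∈ eigs f p, ‖z‖ ≠ 1}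

/-- The `m`-th iterate of an endomorphism as an endomorphism. -/
def iterEndo (f : Endo n) (m : ℕ) : Endo n :=
  ⟨⟨(eapp f)^[m], f.1.continuous.iterate m⟩, f.2.iterate m⟩

/-- The set of points with relatively compact forward orbit. -/
def boundedOrb (f : Endo n) : Set (Cn n) :=
  {p | ∃ K : Set (Cn n), IsCompact K ∧ ∀ k : ℕ, (eapp f)^[k] p ∈ K}

/-- An `ε`-chain (pseudo-orbit) of `f` from `x` to `y`. -/
def EpsChain (f : Endo n) (ε : Cn n → ℝ) (x y : Cn n) : Prop :=
  ∃ N : ℕ, 1 ≤ N ∧ ∃ c : ℕ → Cn n, c 0 = x ∧ c N = y ∧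
    ∀ j < N, dist (eapp f (c j)) (c (j + 1)) < ε (eapp f (c j))

/-- `x` and `y` are chain-equivalent for `f`. -/
def ChainEquiv (f : Endo n) (x y : Cn n) : Prop :=
  ∀ ε : Cn n → ℝ, Continuous ε → (∀ z, 0 < ε z) → EpsChain f ε x y ∧ EpsChain f ε y x

/-- `x` is chain-recurrent for `f`. -/
def ChainRec (f : Endo n) (x : Cn n) : Prop :=
  ∀ ε : Cn n → ℝ, Continuous ε → (∀ z, 0 < ε z) → EpsChain f ε x x

/-- Attracting fixed point. -/
def IsAttFix (f : Endo n) (p : Cn n) : Prop :=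
  eapp f p = p ∧ ∀ z ∈ spectrum ℂ (fderiv ℂ (eapp f) p), ‖z‖ < 1

/-- Repelling fixed point. -/
def IsRepFix (f : Endo n) (p : Cn n) : Prop :=
  eapp f p = p ∧ ∀ z ∈ spectrum ℂ (fderiv ℂ (eapp f) p), 1 < ‖z‖

/-- Saddle fixed point. -/
def IsSadFix (f : Endo n) (p : Cn n) : Prop :=
  eapp f p = p ∧ (∀ z ∈ spectrum ℂ (fderiv ℂ (eapp f) p), ‖z‖ ≠ 1) ∧
    (∃ z ∈ spectrum ℂ (fderiv ℂ (eapp f) p), ‖z‖ < 1) ∧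
    (∃ z ∈ spectrum ℂ (fderiv ℂ (eapp f) p), 1 < ‖z‖)

/-- `f` is a local biholomorphism at `p`: `f` agrees near `p` with a homeomorphism onto an
open set whose inverse is holomorphic. -/
def LocalBiholoAt (f : Endo n) (p : Cn n) : Prop :=
  ∃ φ : PartialHomeomorph (Cn n) (Cn n), p ∈ φ.source ∧ Set.EqOn (eapp f) φ φ.source ∧
    DifferentiableOn ℂ φ.symm φ.target


open MeasureTheory

abbrev WW (n k : ℕ) := Fin (k+1) → Cn n

lemma closed_exists {X Y : Type*} [TopologicalSpace X] [TopologicalSpace Y] {K : Set Y}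
    (hK : IsCompact K) {C : Set (X × Y)} (hC : IsClosed C) :
    IsClosed {x | ∃ y ∈ K, (x, y) ∈ C} := by
  have : CompactSpace K := isCompact_iff_compactSpace.1 hK
  have h2 : IsClosed ((fun q : X × K => (q.1, (q.2 : Y))) ⁻¹' C) := hC.preimage (by fun_prop)
  have h3 := isClosedMap_fst_of_compactSpace (X := X) (Y := K) _ h2
  convert h3 using 1
  ext x
  simp

lemma cont_eval {n : ℕ} : Continuous (fun q : Endo n × Cn n => eapp q.1 q.2) := by
  unfold eapp
  fun_prop

lemma eapp_diff {n : ℕ} (f : Endo n) : Differentiable ℂ (eapp f) := f.2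

lemma cont_fderiv_apply {n : ℕ} (v : Cn n) :
    Continuous (fun q : Endo n × Cn n => fderiv ℂ (eapp q.1) q.2 v) := by
  rw [continuous_iff_continuousAt]
  intro q0
  rw [ContinuousAt, Metric.tendsto_nhds]
  intro ε hε
  have key : ∀ᶠ q in 𝓝 q0, ∀ t ∈ sphere (0 : ℂ) 1,
      ‖eapp q.1 (q.2 + t • v) - eapp q0.1 (q0.2 + t • v)‖ < ε / 2 := by
    apply (isCompact_sphere (0 : ℂ) 1).eventually_forall_of_forall_eventually
    intro t _
    have hc : Continuous (fun z : (Endo n × Cn n) × ℂ =>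
        ‖eapp z.1.1 (z.1.2 + z.2 • v) - eapp q0.1 (q0.2 + z.2 • v)‖) := by
      apply Continuous.norm
      apply Continuous.sub
      · exact cont_eval.comp (f := fun z : (Endo n × Cn n) × ℂ => (z.1.1, z.1.2 + z.2 • v))
          (by fun_prop)
      · exact (eapp_diff q0.1).continuous.comp (by fun_prop)
    have := hc.tendsto (q0, t)
    apply this.eventually_lt_const
    simpa using half_pos hε
  filter_upwards [key] with q hq
  have hd : ∀ r : Endo n × Cn n,
      HasDerivAt (fun t : ℂ => eapp r.1 (r.2 + t • v)) (fderiv ℂ (eapp r.1) r.2 v) 0 := by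
    intro r
    have h1 : HasFDerivAt (eapp r.1) (fderiv ℂ (eapp r.1) r.2) (r.2 + (0 : ℂ) • v) := by
      simpa using (eapp_diff r.1 r.2).hasFDerivAt
    have h2 : HasDerivAt (fun t : ℂ => r.2 + t • v) v 0 := by
      simpa using ((hasDerivAt_id (0 : ℂ)).smul_const v).const_add r.2
    exact h1.comp_hasDerivAt (0 : ℂ) h2
  have hD : ∀ r : Endo n × Cn n, Differentiable ℂ (fun t : ℂ => eapp r.1 (r.2 + t • v)) := by
    intro r
    exact (eapp_diff r.1).comp (by fun_prop)
  have h := Complex.norm_deriv_le_of_forall_mem_sphere_norm_le (c := (0 : ℂ)) (R := 1)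
    (C := ε / 2) (f := fun t => eapp q.1 (q.2 + t • v) - eapp q0.1 (q0.2 + t • v)) one_pos
    ((hD q).sub (hD q0)).diffContOnCl (fun t ht => (hq t ht).le)
  have e := ((hd q).sub (hd q0)).deriv
  have h' : ‖fderiv ℂ (eapp q.1) q.2 v - fderiv ℂ (eapp q0.1) q0.2 v‖ ≤ ε / 2 / 1 := by
    rw [← e]; exact h
  rw [dist_eq_norm]
  linarith

lemma cont_fderiv {n : ℕ} :
    Continuous (fun q : Endo n × Cn n => fderiv ℂ (eapp q.1) q.2) :=
  continuous_clm_apply.2 cont_fderiv_apply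

/-- separating functional -/
def lin (n t : ℕ) : Cn n →L[ℂ] ℂ := ∑ k : Fin n, ((t : ℂ) ^ (k : ℕ)) • EuclideanSpace.proj k

lemma lin_apply (n t : ℕ) (z : Cn n) : lin n t z = ∑ k : Fin n, ((t : ℂ) ^ (k : ℕ)) * z k := by
  simp [lin]

lemma exists_lin {n k : ℕ} (p : WW n k) (hp : Injective p) :
    ∃ t : ℕ, ∀ i j, i ≠ j → lin n t (p i) ≠ lin n t (p j) := by
  classical
  let q : Fin (k+1) × Fin (k+1) → Polynomial ℂ := fun ij =>
    if ij.1 = ij.2 then 1 else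
      ∑ l : Fin n, Polynomial.monomial (l : ℕ) (p ij.1 l - p ij.2 l)
  have hq : ∀ ij, q ij ≠ 0 := by
    rintro ⟨i, j⟩
    by_cases h : i = j
    · simp [q, h]
    · intro h0
      apply h
      apply hp
      ext l
      have := congrArg (fun P => Polynomial.coeff P (l : ℕ)) h0
      simp [q, h, Polynomial.coeff_monomial, Fin.val_inj] at this
      exact sub_eq_zero.1 this
  have hprod : ∏ ij, q ij ≠ 0 := Finset.prod_ne_zero_iff.2 (fun ij _ => hq ij)
  by_contra! hcon
  apply hprod
  apply Polynomial.eq_zero_of_infinite_isRoot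
  apply (Set.infinite_range_of_injective (Nat.cast_injective (R := ℂ))).mono
  rintro _ ⟨t, rfl⟩
  obtain ⟨i, j, hij, he⟩ := hcon t
  simp only [Set.mem_ofPred_eq, Polynomial.IsRoot.def, Polynomial.eval_prod]
  apply Finset.prod_eq_zero (Finset.mem_univ (i, j))
  rw [lin_apply, lin_apply, ← sub_eq_zero, ← Finset.sum_sub_distrib] at he
  simp only [q, hij, if_false, Polynomial.eval_finsetSum, Polynomial.eval_monomial]
  rw [← he]
  apply Finset.sum_congr rfl
  intros
  ring

/-- the bad sets -/
def badE (n k t r : ℕ) : Set (Endo n) :=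
  {f | ∃ q ∈ closedBall (0 : WW n k) r ×ˢ (sphere (0 : WW n k) 1 ×ˢ sphere (0 : ℂ) 1),
    (f, q) ∈ {x : Endo n × (WW n k × WW n k × ℂ) |
      (∀ i, eapp x.1 (x.2.1 i) = x.2.1 (i+1)) ∧
      (∀ i j, i ≠ j → 1 / ((r : ℝ) + 1) ≤ ‖lin n t (x.2.1 i) - lin n t (x.2.1 j)‖) ∧
      ∀ i, fderiv ℂ (eapp x.1) (x.2.1 i) (x.2.2.1 i) = x.2.2.2 • x.2.2.1 (i+1)}}

lemma badE_closed (n k t r : ℕ) : IsClosed (badE n k t r) := by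
  apply closed_exists
  · exact (isCompact_closedBall _ _).prod ((isCompact_sphere _ _).prod (isCompact_sphere _ _))
  simp only [Set.ofPred_and, Set.ofPred_forall]
  refine IsClosed.inter ?_ (IsClosed.inter ?_ ?_)
  · refine isClosed_iInter fun i => isClosed_eq ?_ (by fun_prop)
    exact cont_eval.comp (f := fun x : Endo n × (WW n k × WW n k × ℂ) => (x.1, x.2.1 i))
      (by fun_prop)
  · refine isClosed_iInter fun i => isClosed_iInter fun j => isClosed_iInter fun h => ?_
    exact isClosed_le (by fun_prop) (by fun_prop)
  · refine isClosed_iInter fun i => isClosed_eq ?_ (by fun_prop)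
    apply Continuous.clm_apply
    · exact cont_fderiv.comp (f := fun x : Endo n × (WW n k × WW n k × ℂ) => (x.1, x.2.1 i))
        (by fun_prop)
    · fun_prop

lemma eig_of_spec {V : Type*} [NormedAddCommGroup V] [NormedSpace ℂ V] [FiniteDimensional ℂ V]
    (A : V →L[ℂ] V) (z : ℂ) : z ∈ spectrum ℂ A ↔ ∃ v, v ≠ 0 ∧ A v = z • v := by
  have : CompleteSpace V := FiniteDimensional.complete ℂ V
  rw [ContinuousLinearMap.spectrum_eq, ← Module.End.hasEigenvalue_iff_mem_spectrum]
  constructor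
  · intro h
    obtain ⟨v, hv⟩ := h.exists_hasEigenvector
    exact ⟨v, hv.2, hv.apply_eq_smul⟩
  · rintro ⟨v, hv, h⟩
    exact Module.End.hasEigenvalue_of_hasEigenvector
      (Module.End.hasEigenvector_iff.2 ⟨Module.End.mem_eigenspace_iff.2 h, hv⟩)

lemma mem_badE {n : ℕ} (f : Endo n) (p : Cn n) (hp : IsPer f p) (h : ¬ IsHypPer f p) :
    ∃ k t r, f ∈ badE n k t r := by
  unfold IsHypPer at h
  push Not at h
  obtain ⟨z, hz, hz1⟩ := h hp
  obtain ⟨v, hv, hvz⟩ := (eig_of_spec _ _).1 hz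
  have hper : p ∈ Function.periodicPts (eapp f) := by
    obtain ⟨m, hm, h⟩ := hp
    exact ⟨m, hm, h⟩
  have hpos : 0 < minPer f p := Function.minimalPeriod_pos_of_mem_periodicPts hper
  obtain ⟨k, hk⟩ : ∃ k, minPer f p = k + 1 := ⟨minPer f p - 1, by omega⟩
  rw [hk] at hvz
  have hit : (eapp f)^[k+1] p = p := by
    rw [← hk]; exact Function.iterate_minimalPeriod
  obtain ⟨μ, hμ⟩ := IsAlgClosed.exists_pow_nat_eq z (Nat.succ_pos k)
  have hμ1 : ‖μ‖ = 1 := by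
    have := congrArg norm hμ
    rw [norm_pow, hz1] at this
    exact (pow_eq_one_iff_of_nonneg (norm_nonneg _) (by omega)).1 this
  have hμ0 : μ ≠ 0 := by
    rintro rfl; simp at hμ1
  let P : WW n k := fun i => (eapp f)^[(i : ℕ)] p
  let w : WW n k := fun i => (μ ^ (i : ℕ))⁻¹ • fderiv ℂ ((eapp f)^[(i : ℕ)]) p v
  have hPinj : Injective P := by
    intro i j hij
    apply Fin.ext
    have hi : (i : ℕ) < minimalPeriod (eapp f) p := by
      have := i.2; change _ < minPer f p; omega
    have hj : (j : ℕ) < minimalPeriod (eapp f) p := by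
      have := j.2; change _ < minPer f p; omega
    exact (Function.iterate_injOn_Iio_minimalPeriod (f := eapp f) (x := p)) hi hj hij
  obtain ⟨t, ht⟩ := exists_lin P hPinj
  have hsucc : ∀ i : ℕ, fderiv ℂ (eapp f) ((eapp f)^[i] p) (fderiv ℂ ((eapp f)^[i]) p v)
      = fderiv ℂ ((eapp f)^[i+1]) p v := by
    intro i
    rw [Function.iterate_succ', fderiv_comp _ (eapp_diff f _) ((eapp_diff f).iterate i _)]
    rfl
  have hw0 : w ≠ 0 := by
    intro h
    have := congrFun h 0
    simp [w] at this
    exact hv this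
  have hP1 : ∀ i, eapp f (P i) = P (i+1) := by
    intro i
    simp only [P]
    rw [← Function.iterate_succ_apply' (eapp f)]
    by_cases hi : i = Fin.last k
    · subst hi; simpa using hit
    · rw [Fin.val_add_one, if_neg hi]
  have hw1 : ∀ i, fderiv ℂ (eapp f) (P i) (w i) = μ • w (i+1) := by
    intro i
    simp only [P, w]
    rw [map_smul, hsucc, Fin.val_add_one]
    by_cases hi : i = Fin.last k
    · subst hi
      simp only [Fin.val_last, if_true]
      rw [hvz, ← hμ, smul_smul]
      simp only [pow_zero, inv_one, one_smul, Function.iterate_zero, fderiv_id]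
      simp only [ContinuousLinearMap.id_apply]
      congr 1
      field_simp
      rfl
    · rw [if_neg hi, smul_smul]
      congr 1
      field_simp
      ring
  have hwn : ‖w‖ ≠ 0 := norm_ne_zero_iff.2 hw0
  obtain ⟨r1, hr1⟩ := exists_nat_ge ‖P‖
  have hsep : ∃ r2 : ℕ, ∀ r : ℕ, r2 ≤ r → ∀ i j, i ≠ j →
      1 / ((r : ℝ) + 1) ≤ ‖lin n t (P i) - lin n t (P j)‖ := by
    have : ∀ᶠ r : ℕ in atTop, ∀ i j, i ≠ j →
      1 / ((r : ℝ) + 1) ≤ ‖lin n t (P i) - lin n t (P j)‖ := by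
      rw [eventually_all]; intro i
      rw [eventually_all]; intro j
      by_cases hij : i = j
      · simp [hij]
      · have h1 := tendsto_one_div_add_atTop_nhds_zero_nat (𝕜 := ℝ)
        have h2 : 0 < ‖lin n t (P i) - lin n t (P j)‖ :=
          norm_pos_iff.2 (sub_ne_zero.2 (ht i j hij))
        filter_upwards [h1.eventually_lt_const h2] with r hr _
        exact hr.le
    exact eventually_atTop.1 this
  obtain ⟨r2, hr2⟩ := hsep
  refine ⟨k, t, max r1 r2, ⟨P, ((‖w‖⁻¹ : ℝ) : ℂ) • w, μ⟩, ⟨?_, ?_, ?_⟩, hP1,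
    hr2 _ (le_max_right _ _), ?_⟩
  · rw [mem_closedBall_zero_iff]
    exact hr1.trans (by exact_mod_cast le_max_left _ _)
  · rw [mem_sphere_zero_iff_norm, norm_smul]
    simp [hwn]
  · simpa using hμ1
  · intro i
    simp only [Pi.smul_apply]
    rw [map_smul, hw1, smul_comm]

lemma poly_zero {k : ℕ} (x : Fin (k+1) → ℂ) (hx : Injective x) (q : Polynomial ℂ)
    (hd : q.degree < ((2 * (k+1) : ℕ) : WithBot ℕ)) (h0 : ∀ i, q.eval (x i) = 0)
    (h1 : ∀ i, q.derivative.eval (x i) = 0) : q = 0 := by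
  by_contra hq
  have hdvd : ∏ i : Fin (k+1), (Polynomial.X - Polynomial.C (x i)) ^ 2 ∣ q := by
    apply Finset.prod_dvd_of_coprime
    · intro i _ j _ hij
      exact ((Polynomial.pairwise_coprime_X_sub_C hx) hij).pow
    · intro i _
      rw [← Polynomial.le_rootMultiplicity_iff hq]
      exact (Polynomial.one_lt_rootMultiplicity_iff_isRoot hq).2 ⟨h0 i, h1 i⟩
  have h2 := Polynomial.degree_le_of_dvd hdvd hq
  have h3 : (∏ i : Fin (k+1), (Polynomial.X - Polynomial.C (x i)) ^ 2).degree
      = ((2 * (k+1) : ℕ) : WithBot ℕ) := by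
    rw [Polynomial.degree_prod]
    simp [Polynomial.degree_pow, mul_comm]
  rw [h3] at h2
  exact absurd (lt_of_le_of_lt h2 hd) (lt_irrefl _)

/-- polynomial perturbation -/
def PP {n k : ℕ} (c : WW n k × WW n k) (x : ℂ) : Cn n :=
  ∑ j : Fin (k+1), (x ^ (j : ℕ) • c.1 j + x ^ (k + 1 + (j : ℕ)) • c.2 j)

/-- its derivative -/
def PD {n k : ℕ} (c : WW n k × WW n k) (x : ℂ) : Cn n :=
  ∑ j : Fin (k+1), ((((j : ℕ) : ℂ) * x ^ ((j : ℕ) - 1)) • c.1 j +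
    (((k + 1 + (j : ℕ) : ℕ) : ℂ) * x ^ (k + 1 + (j : ℕ) - 1)) • c.2 j)

lemma PP_deriv {n k : ℕ} (c : WW n k × WW n k) (x : ℂ) : HasDerivAt (PP c) (PD c x) x := by
  unfold PP PD
  apply HasDerivAt.fun_sum
  intro j _
  exact ((hasDerivAt_pow _ x).smul_const _).add ((hasDerivAt_pow _ x).smul_const _)

/-- Hermite interpolation operator -/
def HH {n k : ℕ} (t : ℕ) (p : WW n k) : (WW n k × WW n k) →L[ℂ] (WW n k × WW n k) :=
  LinearMap.toContinuousLinearMap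
    { toFun := fun c => (fun i => PP c (lin n t (p i)), fun i => PD c (lin n t (p i)))
      map_add' := by
        intro c d
        ext i l <;> simp [PP, PD, Finset.sum_add_distrib, mul_add] <;> ring
      map_smul' := by
        intro a c
        ext i l <;> simp [PP, PD, Finset.sum_add_distrib, mul_add, Finset.mul_sum] <;>
          simp only [mul_left_comm a] }

lemma HH_apply {n k : ℕ} (t : ℕ) (p : WW n k) (c : WW n k × WW n k) :
    HH t p c = (fun i => PP c (lin n t (p i)), fun i => PD c (lin n t (p i))) := rfl

lemma HH_inj {n k : ℕ} (t : ℕ) (p : WW n k) (hp : Injective fun i => lin n t (p i)) :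
    Injective (HH t p) := by
  rw [injective_iff_map_eq_zero]
  intro c hc
  rw [HH_apply, Prod.mk_eq_zero] at hc
  have key : ∀ l : Fin n, (∑ j : Fin (k+1), (Polynomial.monomial (j : ℕ) (c.1 j l) +
      Polynomial.monomial (k + 1 + (j : ℕ)) (c.2 j l)) : Polynomial ℂ) = 0 := by
    intro l
    apply poly_zero _ hp
    · rw [← Polynomial.mem_degreeLT]
      apply Submodule.sum_mem
      intro j _
      have hj := j.2
      apply Submodule.add_mem
      · rw [Polynomial.mem_degreeLT]
        exact lt_of_le_of_lt (Polynomial.degree_monomial_le _ _) (by norm_cast; omega)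
      · rw [Polynomial.mem_degreeLT]
        exact lt_of_le_of_lt (Polynomial.degree_monomial_le _ _) (by norm_cast; omega)
    · intro i
      have := congrArg (fun u : Cn n => u l) (congrFun hc.1 i)
      simp [PP] at this
      simp only [Polynomial.eval_finsetSum, Polynomial.eval_add, Polynomial.eval_monomial]
      rw [← this]
      exact Finset.sum_congr rfl fun j _ => by ring
    · intro i
      have := congrArg (fun u : Cn n => u l) (congrFun hc.2 i)
      simp [PD] at this
      simp only [Polynomial.derivative_sum, Polynomial.derivative_add,
        Polynomial.derivative_monomial,
        Polynomial.eval_finsetSum, Polynomial.eval_add, Polynomial.eval_monomial]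
      rw [← this]
      refine Finset.sum_congr rfl fun j _ => ?_
      have : k + 1 + (j : ℕ) - 1 = k + j := by omega
      push_cast [this]
      ring
  ext i l
  · have := congrArg (fun P => Polynomial.coeff P (i : ℕ)) (key l)
    have h2 : ∀ j : Fin (k+1), ¬ (k + 1 + (j : ℕ) = i) := fun j => by have := i.2; omega
    simpa [Polynomial.coeff_monomial, Fin.val_inj, h2] using this
  · have := congrArg (fun P => Polynomial.coeff P (k + 1 + (i : ℕ))) (key l)
    have h2 : ∀ j : Fin (k+1), ¬ ((j : ℕ) = k + 1 + i) := fun j => by have := j.2; omega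
    simpa [Polynomial.coeff_monomial, Fin.val_inj, h2] using this

lemma HH_equiv {n k : ℕ} (t : ℕ) (p : WW n k) (hp : Injective fun i => lin n t (p i)) :
    ∃ e : (WW n k × WW n k) ≃L[ℂ] (WW n k × WW n k), (e : _ →L[ℂ] _) = HH t p := by
  refine ⟨(LinearEquiv.ofInjectiveEndo (HH t p : _ →ₗ[ℂ] _)
    (HH_inj t p hp)).toContinuousLinearEquiv, ?_⟩
  ext1 <;> rfl

lemma HH_smooth {n k : ℕ} (t : ℕ) : ContDiff ℂ 1 (HH t : WW n k → _) := by
  rw [contDiff_clm_apply_iff]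
  intro c
  simp only [HH_apply, PP, PD]
  fun_prop

/-- The perturbed map -/
def pert {n k : ℕ} (f : Endo n) (t : ℕ) (c : (WW n k × WW n k) × ℂ) : Endo n :=
  ⟨⟨fun z => c.2 • eapp f z + PP c.1 (lin n t z), by
    have := (eapp_diff f).continuous
    unfold PP
    fun_prop⟩, by
    have := eapp_diff f
    change Differentiable ℂ (fun z => c.2 • eapp f z + PP c.1 (lin n t z))
    unfold PP
    fun_prop⟩

lemma pert_apply {n k : ℕ} (f : Endo n) (t : ℕ) (c : (WW n k × WW n k) × ℂ) (z : Cn n) :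
    eapp (pert f t c) z = c.2 • eapp f z + PP c.1 (lin n t z) := rfl

lemma pert_one {n k : ℕ} (f : Endo n) (t : ℕ) :
    pert f t ((0, 1) : (WW n k × WW n k) × ℂ) = f := by
  apply Subtype.ext
  ext1 z
  change (1 : ℂ) • eapp f z + PP (0 : WW n k × WW n k) (lin n t z) = eapp f z
  simp [PP]

lemma pert_cont {n k : ℕ} (f : Endo n) (t : ℕ) :
    Continuous (pert f t : (WW n k × WW n k) × ℂ → Endo n) := by
  apply Continuous.subtype_mk
  apply ContinuousMap.continuous_of_continuous_uncurry
  have := (eapp_diff f).continuous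
  change Continuous (fun x : ((WW n k × WW n k) × ℂ) × Cn n =>
    x.1.2 • eapp f x.2 + PP x.1.1 (lin n t x.2))
  unfold PP
  fun_prop

lemma pert_fderiv {n k : ℕ} (f : Endo n) (t : ℕ) (c : (WW n k × WW n k) × ℂ) (z v : Cn n) :
    fderiv ℂ (eapp (pert f t c)) z v
      = c.2 • fderiv ℂ (eapp f) z v + lin n t v • PD c.1 (lin n t z) := by
  have h1 : HasFDerivAt (fun z => c.2 • eapp f z + PP c.1 (lin n t z))
      (c.2 • fderiv ℂ (eapp f) z + (lin n t).smulRight (PD c.1 (lin n t z))) z := by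
    apply HasFDerivAt.add
    · exact (eapp_diff f z).hasFDerivAt.const_smul c.2
    · have := (PP_deriv c.1 (lin n t z)).hasFDerivAt.comp z (lin n t).hasFDerivAt
      exact this.congr_fderiv (by ext1 v; simp)
  have : fderiv ℂ (eapp (pert f t c)) z = _ := h1.fderiv
  rw [this]
  simp

/-- the block operator -/
def TT {n k : ℕ} (f : Endo n) (t : ℕ) (y : WW n k × WW n k) : WW n k →L[ℂ] WW n k :=
  ContinuousLinearMap.pi fun i =>
    (fderiv ℂ (eapp f) (y.1 (i-1)) + (lin n t).smulRight (y.2 (i-1))).comp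
      (ContinuousLinearMap.proj (i-1))

lemma TT_apply {n k : ℕ} (f : Endo n) (t : ℕ) (y : WW n k × WW n k) (v : WW n k) (i) :
    TT f t y v i = fderiv ℂ (eapp f) (y.1 (i-1)) (v (i-1)) + lin n t (v (i-1)) • y.2 (i-1) := rfl

/-- the null set -/
def NN {n k : ℕ} (f : Endo n) (t : ℕ) : Set ((WW n k × WW n k) × ℂ) :=
  {x | ∃ q ∈ sphere (0 : WW n k) 1 ×ˢ sphere (0 : ℂ) 1,
    (x, q) ∈ {y : ((WW n k × WW n k) × ℂ) × (WW n k × ℂ) |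
      y.1.2 • TT f t y.1.1 y.2.1 = y.2.2 • y.2.1}}

lemma NN_closed {n k : ℕ} (f : Endo n) (t : ℕ) : IsClosed (NN f t : Set ((WW n k × WW n k) × ℂ)) := by
  apply closed_exists
  · exact (isCompact_sphere _ _).prod (isCompact_sphere _ _)
  have hf : Continuous (fun p : Cn n => fderiv ℂ (eapp f) p) :=
    cont_fderiv.comp (f := fun p => (f, p)) (by fun_prop)
  apply isClosed_eq _ (by fun_prop)
  have hT : Continuous (fun y : ((WW n k × WW n k) × ℂ) × (WW n k × ℂ) => TT f t y.1.1 y.2.1) := by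
    apply continuous_pi
    intro i
    simp only [TT_apply]
    fun_prop
  fun_prop

lemma slice_null {n k : ℕ} (f : Endo n) (t : ℕ) (y : WW n k × WW n k) :
    (volume : Measure ℂ) (Prod.mk y ⁻¹' (NN f t)) = 0 := by
  have hfin : (spectrum ℂ (TT f t y)).Finite := by
    rw [ContinuousLinearMap.spectrum_eq]
    exact Module.End.finite_spectrum _
  have hsub : Prod.mk y ⁻¹' (NN f t) ⊆ ⋃ a ∈ spectrum ℂ (TT f t y), sphere (0 : ℂ) (‖a‖⁻¹) := by
    rintro s ⟨⟨v, μ⟩, ⟨hv, hμ⟩, h⟩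
    simp only [mem_sphere_zero_iff_norm] at hv hμ
    change s • TT f t y v = μ • v at h
    have hv0 : v ≠ 0 := by rintro rfl; simp at hv
    have hμ0 : μ ≠ 0 := by rintro rfl; simp at hμ
    have hs : s ≠ 0 := by
      rintro rfl
      rw [zero_smul] at h
      exact (smul_ne_zero hμ0 hv0) h.symm
    simp only [Set.mem_iUnion]
    refine ⟨s⁻¹ * μ, (eig_of_spec _ _).2 ⟨v, hv0, ?_⟩, ?_⟩
    · rw [mul_smul, ← h, smul_smul, inv_mul_cancel₀ hs, one_smul]
    · simp [hμ]
  apply measure_mono_null hsub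
  rw [measure_biUnion_null_iff hfin.countable]
  intro a _
  exact Measure.addHaar_sphere _ _ _

lemma NN_null {n k : ℕ} (f : Endo n) (t : ℕ) :
    ((Measure.addHaar : Measure (WW n k × WW n k)).prod (volume : Measure ℂ)) (NN f t) = 0 := by
  rw [Measure.measure_prod_null (NN_closed f t).measurableSet]
  exact Eventually.of_forall fun y => slice_null f t y

/-- parametrisation -/
def Phi {n k : ℕ} (f : Endo n) (t : ℕ) (x : (WW n k × WW n k) × ℂ) : (WW n k × WW n k) × ℂ :=
  ((HH t x.1.1).inverse (fun i => x.1.1 (i+1) - x.2 • eapp f (x.1.1 i), x.2 • x.1.2), x.2)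

lemma Phi_diff {n k : ℕ} (f : Endo n) (t : ℕ) (x : (WW n k × WW n k) × ℂ)
    (hx : Injective fun i => lin n t (x.1.1 i)) : DifferentiableAt ℂ (Phi f t) x := by
  obtain ⟨e, he⟩ := HH_equiv t x.1.1 hx
  have h1 : DifferentiableAt ℂ ContinuousLinearMap.inverse (HH t x.1.1) := by
    rw [← he]
    exact (contDiffAt_map_inverse (n := 1) e).differentiableAt one_ne_zero
  have h2 : DifferentiableAt ℂ (fun x : (WW n k × WW n k) × ℂ => HH t x.1.1) x :=
    ((HH_smooth t).differentiable one_ne_zero).differentiableAt.comp x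
      (f := fun x : (WW n k × WW n k) × ℂ => x.1.1) (by fun_prop)
  have h3 := DifferentiableAt.comp x (g := ContinuousLinearMap.inverse)
    (f := fun x : (WW n k × WW n k) × ℂ => HH t x.1.1) h1 h2
  have hf := eapp_diff f
  unfold Phi
  apply DifferentiableAt.prodMk _ (by fun_prop)
  apply DifferentiableAt.clm_apply h3
  fun_prop

lemma bad_sub {n k : ℕ} (f : Endo n) (t r : ℕ) (c : (WW n k × WW n k) × ℂ) (hs : c.2 ≠ 0)
    (hc : pert f t c ∈ badE n k t r) :
    c ∈ Phi f t '' (NN f t ∩ {x | Injective fun i => lin n t (x.1.1 i)}) := by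
  obtain ⟨⟨p, v, μ⟩, ⟨hp, hv, hμ⟩, h1, h2, h3⟩ := hc
  simp only at h1 h2 h3 hp hv hμ
  have hinj : Injective fun i => lin n t (p i) := by
    intro i j hij
    by_contra hne
    have := h2 i j hne
    simp only at hij
    rw [hij, sub_self, norm_zero] at this
    have : (0 : ℝ) < 1 / ((r : ℝ) + 1) := by positivity
    linarith
  refine ⟨((p, fun i => c.2⁻¹ • PD c.1 (lin n t (p i))), c.2), ⟨⟨(v, μ), ⟨hv, hμ⟩, ?_⟩, hinj⟩, ?_⟩
  · change c.2 • TT f t _ v = μ • v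
    ext1 i
    have := h3 (i-1)
    rw [pert_fderiv, sub_add_cancel] at this
    simp only [Pi.smul_apply, TT_apply]
    rw [← this, smul_add, smul_comm (lin n t _), smul_smul c.2, mul_inv_cancel₀ hs, one_smul]
  · obtain ⟨e, he⟩ := HH_equiv t p hinj
    refine Prod.ext ?_ ?_
    swap
    · rfl
    simp only [Phi]
    rw [← he, ContinuousLinearMap.inverse_equiv]
    have : ((fun i => p (i+1) - c.2 • eapp f (p i)), c.2 • fun i => c.2⁻¹ • PD c.1 (lin n t (p i)))
        = e c.1 := by
      have h4 : e c.1 = HH t p c.1 := by rw [← he]; rfl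
      rw [h4, HH_apply]
      apply Prod.ext
      · ext1 i
        simp only
        rw [← h1 i, pert_apply, add_sub_cancel_left]
      · ext1 i
        simp [smul_smul, hs]
    rw [this]
    exact e.symm_apply_apply _

lemma badE_dense (n k t r : ℕ) : Dense (badE n k t r)ᶜ := by
  rw [dense_iff_inter_open]
  rintro U hU ⟨f, hf⟩
  let ν : Measure ((WW n k × WW n k) × ℂ) := (Measure.addHaar : Measure (WW n k × WW n k)).prod volume
  have hν : ν.IsAddHaarMeasure := by
    have := (inferInstance : (Measure.addHaar : Measure (WW n k × WW n k)).IsAddHaarMeasure)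
    have : MeasurableAdd (WW n k × WW n k) := ContinuousAdd.measurableAdd
    exact Measure.prod.instIsAddHaarMeasure _ _
  have h0 : ν (Phi f t '' (NN f t ∩ {x | Injective fun i => lin n t (x.1.1 i)})) = 0 := by
    apply addHaar_image_eq_zero_of_differentiableOn_of_addHaar_eq_zero
    · intro x hx
      exact ((Phi_diff f t x hx.2).restrictScalars ℝ).differentiableWithinAt
    · exact measure_mono_null Set.inter_subset_left (NN_null f t)
  have hd : Dense {c | c ∉ Phi f t '' (NN f t ∩ {x : (WW n k × WW n k) × ℂ | Injective fun i => lin n t (x.1.1 i)})} := 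
    Measure.dense_of_ae (μ := ν) (measure_eq_zero_iff_ae_notMem.1 h0)
  have hO : IsOpen ((pert f t : (WW n k × WW n k) × ℂ → Endo n) ⁻¹' U ∩ {c | c.2 ≠ 0}) :=
    (hU.preimage (pert_cont f t)).inter (isOpen_ne_fun (by fun_prop) (by fun_prop))
  obtain ⟨c, ⟨hcU, hc0⟩, hc⟩ := hd.inter_open_nonempty _ hO ⟨(0, 1), by
    change pert f t _ ∈ U
    rw [pert_one]; exact hf, one_ne_zero⟩
  exact ⟨pert f t c, hcU, fun hb => hc (bad_sub f t r c hc0 hb)⟩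

/-- For a generic endomorphism of `ℂⁿ` (`n ≥ 1`), every periodic point is hyperbolic. -/
theorem stmt_0 (n : ℕ) (hn : 1 ≤ n) :
    {f : Endo n | ∀ p : Cn n, IsPer f p → IsHypPer f p} ∈ residual (Endo n) := by
  have h : (⋂ k, ⋂ t, ⋂ r, (badE n k t r)ᶜ) ∈ residual (Endo n) := by
    rw [countable_iInter_mem]; intro k
    rw [countable_iInter_mem]; intro t
    rw [countable_iInter_mem]; intro r
    exact residual_of_dense_open (badE_closed n k t r).isOpen_compl (badE_dense n k t r)
  refine mem_of_superset h ?_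
  intro f hf p hp
  by_contra hcon
  obtain ⟨k, t, r, hb⟩ := mem_badE f p hp hcon
  simp only [Set.mem_iInter] at hf
  exact hf k t r hb
end
end

section
/- For every n ≥ 1 and every compact set K ⊆ ℂⁿ, the set 𝒯(1,K) of endomorphisms f ∈ End(ℂⁿ) such that every fixed point of f lying in K is transverse is dense in End(ℂⁿ). (Proposition 2.1 of the paper, proved for Oka-Stein manifolds; specialized to ℂⁿ.) -/
open Function Topology Filter Metric

noncomputable section

variable {n : ℕ}

/-- `𝒯(1,K)`, the set of endomorphisms all of whose fixed points in `K` are transverse,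
is dense in `End(ℂⁿ)`. -/
theorem stmt_1 (n : ℕ) (hn : 1 ≤ n) (K : Set (Cn n)) (hK : IsCompact K) :
    Dense {f : Endo n | ∀ p ∈ K, eapp f p = p →
      (1 : ℂ) ∉ spectrum ℂ (fderiv ℂ (eapp f) p)} := by
  intro f
  let : MeasurableSpace (Cn n) := borel (Cn n)
  have : BorelSpace (Cn n) := ⟨rfl⟩
  have : FiniteDimensional ℝ (Cn n) := FiniteDimensional.complexToReal (Cn n)
  let S : Set (Cn n) := {p | (1 : ℂ) ∈ spectrum ℂ (fderiv ℂ (eapp f) p)}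
  let g : Cn n → Cn n := fun x => x - eapp f x
  let g' : Cn n → (Cn n →L[ℂ] Cn n) := fun p => 1 - fderiv ℂ (eapp f) p
  have hd : Differentiable ℂ (eapp f) := f.2
  have hg : ∀ x, HasFDerivAt g (g' x) x := fun x =>
    (hasFDerivAt_id x).sub (hd x).hasFDerivAt
  have hdet : ∀ x ∈ S, ((g' x).restrictScalars ℝ).det = 0 := by
    intro x hx
    by_contra h
    apply hx
    have hb : Bijective (g' x) := by
      have h2 : IsUnit (((g' x).restrictScalars ℝ : Cn n →L[ℝ] Cn n) : Cn n →ₗ[ℝ] Cn n) :=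
        LinearMap.isUnit_iff_isUnit_det _ |>.2 (isUnit_iff_ne_zero.2 h)
      have h3 := (Module.End.isUnit_iff _).1 h2
      exact h3
    have : IsUnit (g' x) := by
      rw [ContinuousLinearMap.isUnit_iff_bijective]
      exact hb
    rw [spectrum.mem_resolventSet_iff, map_one]
    exact this
  have hnull := MeasureTheory.addHaar_image_eq_zero_of_det_fderivWithin_eq_zero
    (MeasureTheory.Measure.addHaar : MeasureTheory.Measure (Cn n)) (s := S) (f := g)
    (f' := fun x => (g' x).restrictScalars ℝ)
    (fun x _ => ((hg x).restrictScalars ℝ).hasFDerivWithinAt) hdet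
  have hdense : Dense (g '' S)ᶜ := by
    have := MeasureTheory.Measure.dense_of_ae
      (μ := (MeasureTheory.Measure.addHaar : MeasureTheory.Measure (Cn n)))
      (p := fun x => x ∈ (g '' S)ᶜ) (MeasureTheory.measure_eq_zero_iff_ae_notMem.1 hnull)
    exact this
  let T : Cn n → Endo n := fun c => ⟨f.1 + ContinuousMap.const _ c, by
    have : (⇑(f.1 + ContinuousMap.const (Cn n) c)) = fun x => eapp f x + c := rfl
    rw [this]
    exact hd.add_const c⟩
  have hT : Continuous T := by
    refine Continuous.subtype_mk ?_ _
    exact continuous_const.add ContinuousMap.continuous_const'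
  have hT0 : T 0 = f := by
    apply Subtype.ext
    ext1 x
    exact add_zero _
  rw [mem_closure_iff_nhds]
  intro V hV
  have hV0 : T ⁻¹' V ∈ 𝓝 (0 : Cn n) := hT.continuousAt.preimage_mem_nhds (by rwa [hT0])
  obtain ⟨c, hcV, hc⟩ := (mem_closure_iff_nhds.1 (hdense 0)) _ hV0
  refine ⟨T c, hcV, ?_⟩
  intro p _ hp hs
  have he : eapp (T c) = fun x => eapp f x + c := rfl
  rw [he] at hp hs
  rw [fderiv_add_const] at hs
  exact hc ⟨p, hs, sub_eq_of_eq_add' hp.symm⟩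
end
end

section
/- For every n ≥ 1, every compact set K ⊆ ℂⁿ, and every m ≥ 1, the set ℋ(m,K) is dense in 𝒯(m,K); that is, 𝒯(m,K) is contained in the closure of ℋ(m,K) in End(ℂⁿ). (Proposition 2.2 of the paper, proved for Oka-Stein manifolds; specialized to ℂⁿ.) -/
open Function Topology Filter Metric

noncomputable section

variable {n : ℕ}

open MeasureTheory in
lemma aux_cont_fderiv {E F : Type*} [NormedAddCommGroup E] [NormedSpace ℂ E] [FiniteDimensional ℂ E]
    [NormedAddCommGroup F] [NormedSpace ℂ F] [CompleteSpace F] {f : E → F}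
    (hf : Differentiable ℂ f) : Continuous (fderiv ℂ f) := by
  rw [continuous_clm_apply]
  intro v
  rw [continuous_iff_continuousAt]
  intro x₀
  let G : C(E × ℂ, F) := ⟨fun p => f (p.1 + p.2 • v), by
    have := hf.continuous
    fun_prop⟩
  have key : ∀ x, fderiv ℂ f x v = deriv (G.curry x) 0 := by
    intro x
    have h1 : HasDerivAt (fun t : ℂ => x + t • v) v 0 := by
      simpa using ((hasDerivAt_id (0:ℂ)).smul_const v).const_add x
    have h2 : HasFDerivAt f (fderiv ℂ f x) (x + (0:ℂ) • v) := by
      simpa using (hf x).hasFDerivAt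
    exact (h2.comp_hasDerivAt (0:ℂ) h1).deriv.symm
  have h1 : Tendsto (fun x => G.curry x) (𝓝 x₀) (𝓝 (G.curry x₀)) := G.curry.continuous.tendsto x₀
  rw [ContinuousMap.tendsto_iff_tendstoLocallyUniformly, ← tendstoLocallyUniformlyOn_univ] at h1
  have h2 := h1.deriv (Eventually.of_forall (fun x => by
    apply Differentiable.differentiableOn
    show Differentiable ℂ (fun t : ℂ => f (x + t • v))
    fun_prop)) isOpen_univ
  have h3 := h2.tendsto_at (Set.mem_univ (0:ℂ))
  unfold ContinuousAt
  simp only [key]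
  exact h3

open MeasureTheory in
lemma aux_scale_null {Y : Type*} [NormedAddCommGroup Y] [NormedSpace ℝ Y] [FiniteDimensional ℝ Y]
    [MeasurableSpace Y] [BorelSpace Y] (μ : Measure Y) [μ.IsAddHaarMeasure] {B : Set Y}
    (hB : IsClosed B) (h : ∀ y, {t : ℝ | 0 < t ∧ t • y ∈ B}.Countable) : μ B = 0 := by
  haveI : ProperSpace Y := FiniteDimensional.proper ℝ Y
  let S : Set (Y × ℝ) := {p | 0 < p.2 ∧ p.2 • p.1 ∈ B}
  have hS : MeasurableSet S := by
    apply MeasurableSet.inter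
    · exact (isOpen_lt continuous_const continuous_snd).measurableSet
    · exact (hB.preimage (f := fun p : Y × ℝ => p.2 • p.1) (by fun_prop)).measurableSet
  have h0 : (μ.prod (volume : Measure ℝ)) S = 0 := by
    rw [Measure.measure_prod_null hS]
    exact Eventually.of_forall fun y => (h y).measure_zero _
  have h1 : ((volume : Measure ℝ).prod μ) (Prod.swap ⁻¹' S) = 0 := by
    rw [← Measure.prod_swap, Measure.map_apply measurable_swap hS] at h0
    exact h0
  have h2 := Measure.measure_ae_null_of_prod_null h1
  have h3 : ∃ t ∈ Set.Ioi (0:ℝ), μ (Prod.mk t ⁻¹' (Prod.swap ⁻¹' S)) = 0 := by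
    by_contra! hc
    have : (volume : Measure ℝ) (Set.Ioi 0) = 0 :=
      measure_mono_null (fun t ht => hc t ht) h2
    simp at this
  obtain ⟨t, ht, h4⟩ := h3
  have h5 : Prod.mk t ⁻¹' (Prod.swap ⁻¹' S) = (fun x => t • x) ⁻¹' B := by
    ext y
    simp only [S, Set.mem_preimage, Prod.swap, Set.mem_ofPred_eq]
    exact ⟨fun h => h.2, fun h => ⟨ht, h⟩⟩
  rw [h5, Measure.addHaar_preimage_smul μ (ne_of_gt ht)] at h4
  rcases mul_eq_zero.1 h4 with h6 | h6
  · exfalso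
    have : 0 < |(t ^ Module.finrank ℝ Y)⁻¹| := abs_pos.2 (inv_ne_zero (pow_ne_zero _ (ne_of_gt ht)))
    rw [ENNReal.ofReal_eq_zero] at h6
    linarith
  · exact h6

open MeasureTheory in
lemma aux_dense {X Y : Type*} [NormedAddCommGroup X] [NormedSpace ℝ X] [FiniteDimensional ℝ X]
    [NormedAddCommGroup Y] [NormedSpace ℝ Y] [FiniteDimensional ℝ Y] {B : Set Y}
    (hB : IsClosed B) (h : ∀ y, {t : ℝ | 0 < t ∧ t • y ∈ B}.Countable)
    {D : X → Y} (hD : Continuous D) {U : Set X} (Ψ : X × Y → X × Y)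
    (hΨ : ∀ x ∈ U, ∀ y, DifferentiableAt ℝ Ψ (x, y)) :
    Dense (Ψ '' {p | p.1 ∈ U ∧ p.2 + D p.1 ∈ B})ᶜ := by
  haveI : ProperSpace Y := FiniteDimensional.proper ℝ Y
  haveI : ProperSpace X := FiniteDimensional.proper ℝ X
  letI : MeasurableSpace X := borel X
  haveI : BorelSpace X := ⟨rfl⟩
  letI : MeasurableSpace Y := borel Y
  haveI : BorelSpace Y := ⟨rfl⟩
  let μ : Measure X := Measure.addHaar
  let ν : Measure Y := Measure.addHaar
  have hB0 : ν B = 0 := aux_scale_null ν hB h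
  have hnull : (μ.prod ν) {p | p.2 + D p.1 ∈ B} = 0 := by
    rw [Measure.measure_prod_null]
    · refine Eventually.of_forall fun x => ?_
      show ν ((fun y => y + D x) ⁻¹' B) = 0
      rw [measure_preimage_add_right, hB0]
    · exact (hB.preimage (f := fun p : X × Y => p.2 + D p.1) (by fun_prop)).measurableSet
  have hnull2 : (μ.prod ν) {p | p.1 ∈ U ∧ p.2 + D p.1 ∈ B} = 0 :=
    measure_mono_null (fun p hp => hp.2) hnull
  have h3 := addHaar_image_eq_zero_of_differentiableOn_of_addHaar_eq_zero (f := Ψ) (μ.prod ν)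
    (fun p hp => (hΨ p.1 hp.1 p.2).differentiableWithinAt) hnull2
  have h4 : ∀ᵐ p ∂(μ.prod ν), p ∈ (Ψ '' {p | p.1 ∈ U ∧ p.2 + D p.1 ∈ B})ᶜ := by
    exact measure_eq_zero_iff_ae_notMem.1 h3
  exact Measure.dense_of_ae h4

/-- ordered product -/
def aux_pr {R : Type*} [Monoid R] (M : ℕ → R) : ℕ → R
  | 0 => 1
  | (j+1) => M j * aux_pr M j

lemma aux_pr_smul {R : Type*} [Ring R] [Algebra ℝ R] (t : ℝ) (M : ℕ → R) (k : ℕ) :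
    aux_pr (fun j => t • M j) k = t ^ k • aux_pr M k := by
  induction k with
  | zero => simp [aux_pr]
  | succ k ih => simp [aux_pr, ih, smul_smul, pow_succ]

lemma aux_pr_cont {Z R : Type*} [TopologicalSpace Z] [TopologicalSpace R] [Monoid R] [ContinuousMul R]
    {M : Z → ℕ → R}
    (hM : ∀ j, Continuous fun z => M z j) (k : ℕ) : Continuous fun z => aux_pr (M z) k := by
  induction k with
  | zero => simpa [aux_pr] using continuous_const
  | succ k ih => exact (hM k).mul ih

lemma aux_fderiv_iter {E : Type*} [NormedAddCommGroup E] [NormedSpace ℂ E] {g : E → E}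
    (hg : Differentiable ℂ g) (p : E) (k : ℕ) :
    fderiv ℂ (g^[k]) p = aux_pr (fun j => fderiv ℂ g (g^[j] p)) k := by
  induction k with
  | zero => simp only [Function.iterate_zero, aux_pr]; exact fderiv_id
  | succ k ih =>
    rw [Function.iterate_succ', fderiv_comp _ (hg _) ((hg.iterate k) p), ih]
    rfl

/-- nonhyperbolic operators -/
def aux_bad (E : Type*) [NormedAddCommGroup E] [NormedSpace ℂ E] : Set (E →L[ℂ] E) :=
  {A | ∃ z ∈ spectrum ℂ A, ‖z‖ = 1}

lemma aux_bad_closed (E : Type*) [NormedAddCommGroup E] [NormedSpace ℂ E] [CompleteSpace E] :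
    IsClosed (aux_bad E) := by
  have h : IsClosed {p : Metric.sphere (0:ℂ) 1 × (E →L[ℂ] E) |
      ¬ IsUnit (algebraMap ℂ (E →L[ℂ] E) p.1 - p.2)} := by
    have : IsClosed {a : E →L[ℂ] E | ¬ IsUnit a} := Units.isOpen.isClosed_compl
    refine this.preimage (f := fun p : Metric.sphere (0:ℂ) 1 × (E →L[ℂ] E) =>
      algebraMap ℂ (E →L[ℂ] E) p.1 - p.2) ?_
    have := continuous_algebraMap ℂ (E →L[ℂ] E)
    fun_prop
  have h2 := isClosedMap_snd_of_compactSpace _ h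
  convert h2 using 1
  ext A
  simp only [aux_bad, Set.mem_ofPred_eq, Set.mem_image, Prod.exists, spectrum.mem_iff]
  constructor
  · rintro ⟨z, h1, h2⟩
    exact ⟨⟨z, by simpa using h2⟩, A, h1, rfl⟩
  · rintro ⟨⟨z, hz⟩, A', h1, rfl⟩
    exact ⟨z, h1, by simpa using hz⟩

lemma aux_spec_finite (E : Type*) [NormedAddCommGroup E] [NormedSpace ℂ E] [FiniteDimensional ℂ E]
    (A : E →L[ℂ] E) : (spectrum ℂ A).Finite := by
  have := Module.End.finite_spectrum (K := ℂ) (V := E) ((Module.End.toContinuousLinearMap (𝕜 := ℂ) E).symm A)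
  rwa [AlgEquiv.spectrum_eq] at this

lemma aux_bad_countable (E : Type*) [NormedAddCommGroup E] [NormedSpace ℂ E] [FiniteDimensional ℂ E]
    (A : E →L[ℂ] E) (k : ℕ) :
    {t : ℝ | 0 < t ∧ t ^ (k+1) • A ∈ aux_bad E}.Countable := by
  have : {t : ℝ | 0 < t ∧ t ^ (k+1) • A ∈ aux_bad E} ⊆
      ⋃ w ∈ spectrum ℂ A, {t : ℝ | 0 < t ∧ t ^ (k+1) * ‖w‖ = 1} := by
    rintro t ⟨ht, z, hz, hz1⟩
    have hne : ((t:ℂ) ^ (k+1)) ≠ 0 := pow_ne_zero _ (by exact_mod_cast ht.ne')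
    have e : t ^ (k+1) • A = (Units.mk0 _ hne) • A := by
      ext v
      simp [Units.smul_def, ← Complex.coe_smul]
    rw [e, spectrum.unit_smul_eq_smul] at hz
    obtain ⟨w, hw, rfl⟩ := hz
    simp only [Set.mem_iUnion]
    refine ⟨w, hw, ht, ?_⟩
    simpa [Units.smul_def, abs_of_pos ht] using hz1
  refine Set.Countable.mono this ?_
  refine (aux_spec_finite E A).countable.biUnion ?_
  intro w _
  apply Set.Subsingleton.countable
  rintro s ⟨hs, hs1⟩ t ⟨ht, ht1⟩
  have hw : ‖w‖ ≠ 0 := by rintro h; simp [h] at hs1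
  have : s ^ (k+1) = t ^ (k+1) := mul_right_cancel₀ hw (hs1.trans ht1.symm)
  exact (pow_left_inj₀ hs.le ht.le (Nat.succ_ne_zero k)).1 this

/-- affine functions -/
def aux_aff (n : ℕ) : Submodule ℂ (Cn n → ℂ) :=
  LinearMap.range ({ toFun := fun p x => p.1 + p.2 x
                     map_add' := fun p q => by
                       ext x
                       simp only [Prod.fst_add, Prod.snd_add, add_apply, Pi.add_apply]
                       ring
                     map_smul' := fun c p => by
                       ext x
                       simp [mul_add] } : (ℂ × (Cn n →L[ℂ] ℂ)) →ₗ[ℂ] (Cn n → ℂ))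

lemma aux_aff_mem (c : ℂ) (l : Cn n →L[ℂ] ℂ) : (fun x => c + l x) ∈ aux_aff n := ⟨(c, l), rfl⟩

lemma aux_aff_one : (1 : Cn n → ℂ) ∈ aux_aff n := ⟨(1, 0), by ext x; simp⟩

lemma aux_aff_fg (N : ℕ) : (aux_aff n ^ N).FG := by
  apply Submodule.FG.pow
  unfold aux_aff
  rw [LinearMap.range_eq_map]
  exact Submodule.FG.map _ (Module.finite_def.1 inferInstance)

lemma aux_aff_contDiff (N : ℕ) : ∀ φ ∈ aux_aff n ^ N, ContDiff ℂ 2 φ := by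
  intro φ hφ
  induction hφ using Submodule.pow_induction_on_left' with
  | algebraMap r => exact contDiff_const
  | add x y i hx hy h1 h2 => exact h1.add h2
  | mem_mul p hp i x hx h1 =>
    obtain ⟨⟨c, l⟩, rfl⟩ := hp
    refine ContDiff.mul ?_ h1
    exact contDiff_const.add l.contDiff

lemma aux_aff_mono {a b : ℕ} (h : a ≤ b) : aux_aff n ^ a ≤ aux_aff n ^ b := by
  obtain ⟨c, rfl⟩ := Nat.exists_eq_add_of_le h
  rw [pow_add]
  intro x hx
  have h1 : (1 : Cn n → ℂ) ∈ aux_aff n ^ c := by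
    simpa using Submodule.pow_mem_pow (aux_aff n) aux_aff_one c
  simpa using Submodule.mul_mem_mul hx h1

lemma aux_prod_mem {ι : Type*} (s : Finset ι) (g : ι → Cn n → ℂ) (h : ∀ i ∈ s, g i ∈ aux_aff n ^ 2) :
    ∏ i ∈ s, g i ∈ aux_aff n ^ (2 * s.card) := by
  classical
  induction s using Finset.induction_on with
  | empty => simp
  | insert a s ha ih =>
    rw [Finset.prod_insert ha, Finset.card_insert_of_notMem ha, mul_add, add_comm, pow_add]
    exact Submodule.mul_mem_mul (h _ (by simp)) (ih fun i hi => h i (by simp [hi]))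

lemma aux_sep (x y : Cn n) (h : x ≠ y) : ∃ g ∈ aux_aff n, g x = 1 ∧ g y = 0 := by
  obtain ⟨i, hi⟩ : ∃ i, x i ≠ y i := by
    by_contra! hc
    exact h (by ext i; exact hc i)
  have hd : x i - y i ≠ 0 := sub_ne_zero.2 hi
  refine ⟨_, aux_aff_mem (-(x i - y i)⁻¹ * y i) ((x i - y i)⁻¹ • EuclideanSpace.proj i), ?_, ?_⟩
  · simp; field_simp; ring
  · simp

lemma aux_bump {k : ℕ} (x : Fin k → Cn n) (hx : Injective x) (i : Fin k) :
    ∃ q ∈ aux_aff n ^ (2 * k), q (x i) = 1 ∧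
      ∀ j, j ≠ i → ∃ g r : Cn n → ℂ, ContDiff ℂ 2 g ∧ ContDiff ℂ 2 r ∧ q = g * (g * r) ∧ g (x j) = 0 := by
  classical
  have : ∀ j, ∃ g ∈ aux_aff n, g (x i) = 1 ∧ (j ≠ i → g (x j) = 0) := by
    intro j
    by_cases h : j = i
    · exact ⟨1, aux_aff_one, rfl, fun h' => absurd h h'⟩
    · obtain ⟨g, h1, h2, h3⟩ := aux_sep (x i) (x j) (fun e => h (hx e.symm))
      exact ⟨g, h1, h2, fun _ => h3⟩
  choose g hg h1 h2 using this
  refine ⟨∏ j, (g j)^2, ?_, ?_, ?_⟩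
  · have := aux_prod_mem Finset.univ (fun j => (g j)^2) (fun j _ => Submodule.pow_mem_pow _ (hg j) 2)
    simpa using this
  · simp [h1]
  · intro j hj
    refine ⟨g j, ∏ l ∈ Finset.univ.erase j, (g l)^2, ?_, ?_, ?_, h2 j hj⟩
    · exact aux_aff_contDiff 1 _ (by simpa using hg j)
    · exact aux_aff_contDiff _ _ (aux_prod_mem (Finset.univ.erase j) (fun j => (g j)^2)
        (fun j _ => Submodule.pow_mem_pow _ (hg j) 2))
    · rw [← Finset.mul_prod_erase Finset.univ _ (Finset.mem_univ j)]
      ring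

lemma aux_interp1 {k : ℕ} (x : Fin k → Cn n) (hx : Injective x) (c : ℂ) (l : Cn n →L[ℂ] ℂ)
    (i : Fin k) :
    ∃ φ ∈ aux_aff n ^ (2 * k + 1), φ (x i) = c ∧ fderiv ℂ φ (x i) = l ∧
      ∀ j, j ≠ i → φ (x j) = 0 ∧ fderiv ℂ φ (x j) = 0 := by
  obtain ⟨q, hq, hq1, hq2⟩ := aux_bump x hx i
  let L : Cn n →L[ℂ] ℂ := l - c • fderiv ℂ q (x i)
  let h : Cn n → ℂ := fun y => (c - L (x i)) + L y
  have hh : h ∈ aux_aff n := aux_aff_mem _ _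
  have dq : Differentiable ℂ q := (aux_aff_contDiff _ q hq).differentiable (by norm_num)
  have hL : ∀ y, HasFDerivAt h L y := fun y => (L.hasFDerivAt).const_add _
  refine ⟨q * h, ?_, ?_, ?_, ?_⟩
  · rw [pow_succ]
    exact Submodule.mul_mem_mul hq hh
  · simp [hq1, h]
  · have := ((dq (x i)).hasFDerivAt.mul (hL (x i))).fderiv
    rw [this, hq1]
    simp [h, L]
  · intro j hj
    obtain ⟨g, r, hg, hr, rfl, h0⟩ := hq2 j hj
    refine ⟨by simp [h0], ?_⟩
    have d1 : DifferentiableAt ℂ g (x j) := (hg.differentiable (by norm_num)) _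
    have d2 : DifferentiableAt ℂ r (x j) := (hr.differentiable (by norm_num)) _
    have := (d1.hasFDerivAt.mul ((d1.hasFDerivAt.mul d2.hasFDerivAt).mul (hL (x j)))).fderiv
    rw [mul_assoc, this]
    ext w
    simp [h0]

lemma aux_interp {k : ℕ} (x : Fin k → Cn n) (hx : Injective x) (c : Fin k → ℂ)
    (l : Fin k → Cn n →L[ℂ] ℂ) :
    ∃ φ ∈ aux_aff n ^ (2 * k + 1), ∀ i, φ (x i) = c i ∧ fderiv ℂ φ (x i) = l i := by
  classical
  choose φ h1 h2 h3 h4 using fun i => aux_interp1 x hx (c i) (l i) i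
  refine ⟨∑ i, φ i, Submodule.sum_mem _ fun i _ => h1 i, fun i => ⟨?_, ?_⟩⟩
  · rw [Finset.sum_apply, Finset.sum_eq_single i (fun j _ hj => (h4 j i hj.symm).1) (by simp)]
    exact h2 i
  · rw [fderiv_sum (fun j _ => ((aux_aff_contDiff _ _ (h1 j)).differentiable (by norm_num)) _),
      Finset.sum_eq_single i (fun j _ hj => (h4 j i hj.symm).2) (by simp)]
    exact h3 i

lemma aux_family (n m : ℕ) : ∃ (d : ℕ) (P : (Fin n → Fin d → ℂ) →ₗ[ℂ] (Cn n → Cn n)),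
    (∀ a, ContDiff ℂ 2 (P a)) ∧ ∀ k, k ≤ m → ∀ x : Fin k → Cn n, Injective x →
      ∀ (v : Fin k → Cn n) (N : Fin k → Cn n →L[ℂ] Cn n),
        ∃ a, ∀ i, P a (x i) = v i ∧ fderiv ℂ (P a) (x i) = N i := by
  let V := aux_aff n ^ (2 * m + 1)
  haveI : Module.Finite ℂ V := Module.Finite.iff_fg.2 (aux_aff_fg _)
  let b := Module.finBasis ℂ V
  let e : (Fin (Module.finrank ℂ V) → ℂ) ≃ₗ[ℂ] V := b.equivFun.symm
  let P : (Fin n → Fin (Module.finrank ℂ V) → ℂ) →ₗ[ℂ] (Cn n → Cn n) :=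
    { toFun := fun a x => WithLp.toLp 2 (fun l => (e (a l) : Cn n → ℂ) x)
      map_add' := fun a a' => by
        ext x l
        simp
      map_smul' := fun a a' => by
        ext x l
        simp }
  have hP : ∀ a, ContDiff ℂ 2 (P a) := by
    intro a
    rw [contDiff_euclidean]
    intro l
    exact aux_aff_contDiff _ _ (e (a l)).2
  refine ⟨_, P, hP, ?_⟩
  intro k hk x hx v N
  choose φ h1 h2 using fun l : Fin n => aux_interp x hx (fun i => v i l)
    (fun i => (EuclideanSpace.proj l).comp (N i))
  have h1' : ∀ l, φ l ∈ V := fun l => aux_aff_mono (by omega) (h1 l)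
  refine ⟨fun l => e.symm ⟨φ l, h1' l⟩, fun i => ?_⟩
  have hPa : P (fun l => e.symm ⟨φ l, h1' l⟩) = fun x => WithLp.toLp 2 (fun l => φ l x) := by
    ext x l
    simp [P]
  constructor
  · rw [hPa]
    ext l
    exact (h2 l i).1
  · have hd := ((hP (fun l => e.symm ⟨φ l, h1' l⟩)).differentiable (by norm_num)) (x i)
    ext w l
    have h5 := ((EuclideanSpace.proj l : Cn n →L[ℂ] ℂ).hasFDerivAt.comp (x i) hd.hasFDerivAt).fderiv
    have h6 : (⇑(EuclideanSpace.proj l : Cn n →L[ℂ] ℂ) ∘ P (fun l => e.symm ⟨φ l, h1' l⟩)) = φ l := by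
      ext y
      simp [hPa]
    rw [h6, (h2 l i).2] at h5
    have := congrArg (fun T : Cn n →L[ℂ] ℂ => T w) h5
    simpa using this.symm

lemma aux_fd_clm (E : Type*) [NormedAddCommGroup E] [NormedSpace ℂ E] [FiniteDimensional ℂ E] :
    FiniteDimensional ℝ (E →L[ℂ] E) := Module.Finite.trans (R := ℝ) ℂ _

lemma aux_diff_psi {X Y : Type*} [NormedAddCommGroup X] [NormedSpace ℂ X] [CompleteSpace X]
    [NormedAddCommGroup Y] [NormedSpace ℂ Y] [CompleteSpace Y] (T : X → (X × Y →L[ℂ] X × Y))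
    (hT : ContDiff ℂ 1 T) (v : X → X) (hv : Differentiable ℂ v) (x : X) (hx : IsUnit (T x)) (y : Y) :
    DifferentiableAt ℝ (fun p : X × Y => Ring.inverse (T p.1) (v p.1, p.2)) (x, y) := by
  have h1 : DifferentiableAt ℂ (fun p : X × Y => Ring.inverse (T p.1) (v p.1, p.2)) (x, y) := by
    apply DifferentiableAt.clm_apply
    · have h2 : DifferentiableAt ℂ Ring.inverse (T x) := differentiableAt_inverse hx
      have h3 : DifferentiableAt ℂ T x := hT.differentiable (by norm_num) x
      have h4 : DifferentiableAt ℂ (fun x => Ring.inverse (T x)) x := h2.comp x h3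
      exact DifferentiableAt.comp (g := fun x => Ring.inverse (T x)) (f := Prod.fst) (x, y) h4
        differentiableAt_fst
    · exact ((hv x).comp (x, y) differentiableAt_fst).prodMk differentiableAt_snd
  exact h1.restrictScalars ℝ

lemma aux_units_open (E : Type*) [NormedAddCommGroup E] [NormedSpace ℂ E] [CompleteSpace E] :
    IsOpen {a : E →L[ℂ] E | IsUnit a} := Units.isOpen

section aux_main
variable {A : Type*} [NormedAddCommGroup A] [NormedSpace ℂ A] [FiniteDimensional ℂ A]

/-- 1-jets at a tuple of points -/
def aux_jet (P : A →ₗ[ℂ] (Cn n → Cn n)) (hP : ∀ a, ContDiff ℂ 2 (P a)) (k : ℕ)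
    (x : Fin k → Cn n) : A →L[ℂ] (Fin k → Cn n) × (Fin k → Cn n →L[ℂ] Cn n) :=
  LinearMap.toContinuousLinearMap
    { toFun := fun a => (fun i => P a (x i), fun i => fderiv ℂ (P a) (x i))
      map_add' := fun a b => by
        have h : ∀ a, Differentiable ℂ (P a) := fun a => (hP a).differentiable (by norm_num)
        ext1
        · funext i
          simp
        · funext i
          simp only [map_add]
          exact fderiv_add (h a _) (h b _)
      map_smul' := fun c a => by
        have h : ∀ a, Differentiable ℂ (P a) := fun a => (hP a).differentiable (by norm_num)
        ext1
        · funext i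
          simp
        · funext i
          simp only [map_smul]
          exact fderiv_const_smul (h a _) c }

lemma aux_jet_apply (P : A →ₗ[ℂ] (Cn n → Cn n)) (hP : ∀ a, ContDiff ℂ 2 (P a)) (k : ℕ)
    (x : Fin k → Cn n) (a : A) : aux_jet P hP k x a =
      (fun i => P a (x i), fun i => fderiv ℂ (P a) (x i)) := rfl

lemma aux_jet_contDiff (P : A →ₗ[ℂ] (Cn n → Cn n)) (hP : ∀ a, ContDiff ℂ 2 (P a)) (k : ℕ) :
    ContDiff ℂ 1 (aux_jet P hP k) := by
  rw [contDiff_clm_apply_iff]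
  intro a
  simp only [aux_jet_apply]
  refine ContDiff.prodMk ?_ ?_
  · rw [contDiff_pi]
    intro i
    exact ((hP a).of_le (by norm_num)).comp (contDiff_apply ℂ (Cn n) i)
  · rw [contDiff_pi]
    intro i
    exact ((hP a).fderiv_right (m := 1) (by norm_num)).comp (contDiff_apply ℂ (Cn n) i)

/-- parameters for which no bad cycle lies in `W` -/
def aux_good (P : A →ₗ[ℂ] (Cn n → Cn n)) (f : Cn n → Cn n) (k : ℕ) (W : Set (Fin (k+1) → Cn n)) :
    Set A :=
  {a | ∀ x ∈ W, (∀ i, f (x i) + P a (x i) = x (i+1)) →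
    aux_pr (fun j : ℕ => fderiv ℂ f (x (Fin.ofNat (k+1) j)) + fderiv ℂ (P a) (x (Fin.ofNat (k+1) j))) (k+1)
      ∉ aux_bad (Cn n)}

lemma aux_good_open (P : A →ₗ[ℂ] (Cn n → Cn n)) (hP : ∀ a, ContDiff ℂ 2 (P a))
    {f : Cn n → Cn n} (hf : Differentiable ℂ f) (k : ℕ) {W : Set (Fin (k+1) → Cn n)}
    (hW : IsCompact W) : IsOpen (aux_good P f k W) := by
  haveI : CompactSpace W := isCompact_iff_compactSpace.1 hW
  have hj : Continuous fun p : W × A => aux_jet P hP (k+1) p.1 p.2 :=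
    ((aux_jet_contDiff P hP (k+1)).continuous.comp (by fun_prop : Continuous fun p : W × A => (p.1 : Fin (k+1) → Cn n))).clm_apply continuous_snd
  have hx : ∀ i, Continuous fun p : W × A => (p.1 : Fin (k+1) → Cn n) i := fun i =>
    (continuous_apply i).comp (by fun_prop)
  have hj1 : ∀ i, Continuous fun p : W × A => P p.2 ((p.1 : Fin (k+1) → Cn n) i) := fun i =>
    (continuous_apply i).comp (continuous_fst.comp hj)
  have hj2 : ∀ i, Continuous fun p : W × A => fderiv ℂ (P p.2) ((p.1 : Fin (k+1) → Cn n) i) := fun i =>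
    (continuous_apply i).comp (continuous_snd.comp hj)
  have h : IsClosed {p : W × A | (∀ i, f (p.1.1 i) + P p.2 (p.1.1 i) = p.1.1 (i+1)) ∧
      aux_pr (fun j : ℕ => fderiv ℂ f (p.1.1 (Fin.ofNat (k+1) j)) + fderiv ℂ (P p.2) (p.1.1 (Fin.ofNat (k+1) j))) (k+1)
      ∈ aux_bad (Cn n)} := by
    apply IsClosed.inter
    · show IsClosed {p : W × A | ∀ i, f (p.1.1 i) + P p.2 (p.1.1 i) = p.1.1 (i+1)}
      simp only [Set.ofPred_forall]
      exact isClosed_iInter fun i =>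
        isClosed_eq ((hf.continuous.comp (hx i)).add (hj1 i)) (hx (i+1))
    · refine (aux_bad_closed (Cn n)).preimage (aux_pr_cont (fun j => ?_) (k+1))
      exact ((aux_cont_fderiv hf).comp (hx _)).add (hj2 _)
  have h2 := isClosedMap_snd_of_compactSpace _ h
  convert h2.isOpen_compl using 1
  ext a
  simp only [aux_good, Set.mem_ofPred_eq, Set.mem_compl_iff, Set.mem_image, Prod.exists]
  constructor
  · rintro h ⟨⟨x, hx⟩, b, ⟨h1, h2⟩, rfl⟩
    exact h x hx h1 h2
  · intro h x hx h1 h2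
    exact h ⟨⟨x, hx⟩, a, ⟨h1, h2⟩, rfl⟩

lemma aux_local (P : A →ₗ[ℂ] (Cn n → Cn n)) (hP : ∀ a, ContDiff ℂ 2 (P a)) (k : ℕ)
    (x₀ : Fin (k+1) → Cn n) (hs : Surjective (aux_jet P hP (k+1) x₀)) :
    ∃ W ∈ 𝓝 x₀, IsCompact W ∧ ∀ f : Cn n → Cn n, Differentiable ℂ f → Dense (aux_good P f k W) := by
  obtain ⟨H, hH⟩ := ContinuousLinearMap.exists_rightInverse_of_surjective (aux_jet P hP (k+1) x₀)
    (LinearMap.range_eq_top.2 hs)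
  let T := fun x : Fin (k+1) → Cn n => (aux_jet P hP (k+1) x).comp H
  have hT : ContDiff ℂ 1 T := (aux_jet_contDiff P hP (k+1)).clm_comp contDiff_const
  let U := {x | IsUnit (T x)}
  have hUo : IsOpen {a : ((Fin (k+1) → Cn n) × (Fin (k+1) → Cn n →L[ℂ] Cn n)) →L[ℂ]
      ((Fin (k+1) → Cn n) × (Fin (k+1) → Cn n →L[ℂ] Cn n)) | IsUnit a} :=
    aux_units_open _
  have hU : IsOpen U := hUo.preimage hT.continuous
  have hx₀ : x₀ ∈ U := by
    show IsUnit (T x₀)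
    have : T x₀ = 1 := hH
    rw [this]
    exact isUnit_one
  obtain ⟨W, hW, hWU, hWc⟩ := local_compact_nhds (hU.mem_nhds hx₀)
  refine ⟨W, hW, hWc, ?_⟩
  intro f hf a
  let F : Cn n → Cn n := fun y => f y + P a y
  have hPd : ∀ a, Differentiable ℂ (P a) := fun a => (hP a).differentiable (by norm_num)
  have hF : Differentiable ℂ F := hf.add (hPd a)
  have hDF : ∀ y, fderiv ℂ F y = fderiv ℂ f y + fderiv ℂ (P a) y :=
    fun y => fderiv_add (hf y) (hPd a y)
  let B : Set (Fin (k+1) → Cn n →L[ℂ] Cn n) :=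
    {M | aux_pr (fun j : ℕ => M (Fin.ofNat (k+1) j)) (k+1) ∈ aux_bad (Cn n)}
  have hB : IsClosed B := (aux_bad_closed (Cn n)).preimage
    (aux_pr_cont (M := fun (M : Fin (k+1) → Cn n →L[ℂ] Cn n) (j : ℕ) => M (Fin.ofNat (k+1) j))
      (fun j => continuous_apply _) (k+1))
  have hB2 : ∀ M, {t : ℝ | 0 < t ∧ t • M ∈ B}.Countable := by
    intro M
    convert aux_bad_countable (Cn n) (aux_pr (fun j : ℕ => M (Fin.ofNat (k+1) j)) (k+1)) k using 4
    rw [← aux_pr_smul]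
    rfl
  let D : (Fin (k+1) → Cn n) → (Fin (k+1) → Cn n →L[ℂ] Cn n) := fun x i => fderiv ℂ F (x i)
  have hD : Continuous D := continuous_pi fun i => (aux_cont_fderiv hF).comp (continuous_apply i)
  let Ψ : (Fin (k+1) → Cn n) × (Fin (k+1) → Cn n →L[ℂ] Cn n) →
      (Fin (k+1) → Cn n) × (Fin (k+1) → Cn n →L[ℂ] Cn n) :=
    fun p => Ring.inverse (T p.1) ((fun i => p.1 (i+1) - F (p.1 i)), p.2)
  have hΨ : ∀ x ∈ U, ∀ y, DifferentiableAt ℝ Ψ (x, y) := by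
    intro x hx y
    refine aux_diff_psi T hT (fun x i => x (i+1) - F (x i)) ?_ x hx y
    rw [differentiable_pi]
    intro i
    fun_prop
  haveI : FiniteDimensional ℝ (Fin (k+1) → Cn n) := FiniteDimensional.complexToReal _
  haveI : FiniteDimensional ℝ (Fin (k+1) → Cn n →L[ℂ] Cn n) :=
    haveI := aux_fd_clm (Cn n)
    inferInstance
  have hdense := aux_dense hB hB2 hD (U := U) Ψ hΨ
  have hsub : ∀ c ∈ (Ψ '' {p | p.1 ∈ U ∧ p.2 + D p.1 ∈ B})ᶜ, a + H c ∈ aux_good P f k W := by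
    intro c hc x hx hcyc hbad
    apply hc
    have hxU : IsUnit (T x) := hWU hx
    refine ⟨(x, fun i => fderiv ℂ (P (H c)) (x i)), ⟨hWU hx, ?_⟩, ?_⟩
    · show aux_pr _ (k+1) ∈ aux_bad (Cn n)
      convert hbad using 2
      funext j
      show fderiv ℂ (P (H c)) _ + fderiv ℂ F _ = _
      rw [hDF, map_add, show (P a + P (H c)) = (fun y => P a y + P (H c) y) from rfl,
        fderiv_fun_add (hPd a _) (hPd (H c) _)]
      abel
    · have e : (((fun i => x (i+1) - F (x i)), fun i => fderiv ℂ (P (H c)) (x i)) :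
          (Fin (k+1) → Cn n) × (Fin (k+1) → Cn n →L[ℂ] Cn n)) = T x c := by
        show _ = aux_jet P hP (k+1) x (H c)
        rw [aux_jet_apply]
        congr 1
        funext i
        rw [← hcyc i]
        simp [F]
      show Ring.inverse (T x) _ = c
      rw [e, ← mul_apply_eq_comp, Ring.inverse_mul_cancel _ hxU]
      rfl
  have h0 : (0 : (Fin (k+1) → Cn n) × (Fin (k+1) → Cn n →L[ℂ] Cn n)) ∈ closure _ := hdense 0
  have hc : Continuous fun c => a + H c := by fun_prop
  have := map_mem_closure hc h0 hsub
  simpa using this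

end aux_main

/-- `ℋ(m,K)` is dense in `𝒯(m,K)`. -/
theorem stmt_2 (n : ℕ) (hn : 1 ≤ n) (K : Set (Cn n)) (hK : IsCompact K) (m : ℕ) (hm : 1 ≤ m) :
    TransSet n m K ⊆ closure (HypSet n m K) := by
  intro f _
  obtain ⟨d, P, hP, hint⟩ := aux_family n m
  have hf : Differentiable ℂ (eapp f) := f.2
  have hPd : ∀ a, Differentiable ℂ (P a) := fun a => (hP a).differentiable (by norm_num)
  have hsurj : ∀ k : Fin m, ∀ x : Fin (k+1) → Cn n, Injective x →
      Surjective (aux_jet P hP (k+1) x) := by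
    rintro k x hx ⟨v, N⟩
    obtain ⟨a, ha⟩ := hint (k+1) (by omega) x hx v N
    refine ⟨a, ?_⟩
    rw [aux_jet_apply]
    ext1
    · funext i
      exact (ha i).1
    · funext i
      exact (ha i).2
  have hloc : ∀ k : Fin m, ∀ x : Fin (k+1) → Cn n, ∃ W : Set (Fin (k+1) → Cn n), Injective x →
      W ∈ 𝓝 x ∧ IsCompact W ∧ Dense (aux_good P (eapp f) k W) := by
    intro k x
    by_cases hx : Injective x
    · obtain ⟨W, h1, h2, h3⟩ := aux_local P hP k x (hsurj k x hx)
      exact ⟨W, fun _ => ⟨h1, h2, h3 _ hf⟩⟩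
    · exact ⟨∅, fun h => absurd h hx⟩
  choose W hW using hloc
  have hcov : ∀ k : Fin m, ∃ t ⊆ {x : Fin (k+1) → Cn n | Injective x}, t.Countable ∧
      {x : Fin (k+1) → Cn n | Injective x} ⊆ ⋃ x ∈ t, W k x := fun k =>
    TopologicalSpace.countable_cover_nhdsWithin
      fun x hx => mem_nhdsWithin_of_mem_nhds (hW k x hx).1
  choose t ht htc hcov using hcov
  have hG : Dense (⋂ k : Fin m, ⋂ x ∈ t k, aux_good P (eapp f) k (W k x)) := by
    have hk : ∀ k : Fin m, IsGδ (⋂ x ∈ t k, aux_good P (eapp f) k (W k x)) ∧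
        Dense (⋂ x ∈ t k, aux_good P (eapp f) k (W k x)) := fun k =>
      ⟨IsGδ.biInter (htc k) fun x hx => (aux_good_open P hP hf k (hW k x (ht k hx)).2.1).isGδ,
        dense_biInter_of_isOpen (fun x hx => aux_good_open P hP hf k (hW k x (ht k hx)).2.1)
        (htc k) fun x hx => (hW k x (ht k hx)).2.2⟩
    exact dense_iInter_of_Gδ (fun k => (hk k).1) fun k => (hk k).2
  have hPc : Continuous fun p : (Fin n → Fin d → ℂ) × Cn n => P p.1 p.2 := by
    have h1 : Continuous fun p : (Fin n → Fin d → ℂ) × Cn n =>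
        aux_jet P hP 1 (fun _ => p.2) p.1 :=
      ((aux_jet_contDiff P hP 1).continuous.comp (by fun_prop)).clm_apply continuous_fst
    exact (continuous_apply (0 : Fin 1)).comp (continuous_fst.comp h1)
  let g : (Fin n → Fin d → ℂ) → Endo n := fun a =>
    ⟨⟨fun y => eapp f y + P a y, hf.continuous.add (hPd a).continuous⟩, hf.add (hPd a)⟩
  have hg : Continuous g := by
    refine Continuous.subtype_mk (ContinuousMap.continuous_of_continuous_uncurry _ ?_) _
    exact (hf.continuous.comp continuous_snd).add hPc
  have hg0 : g 0 = f := by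
    apply Subtype.ext
    ext1 y
    show eapp f y + P 0 y = f.1 y
    simp [eapp]
  have hmem : ∀ a ∈ ⋂ k : Fin m, ⋂ x ∈ t k, aux_good P (eapp f) k (W k x), g a ∈ HypSet n m K := by
    intro a ha p _ hper hle z hz hz1
    have hpos : 0 < minPer (g a) p := by
      obtain ⟨j, hj, hjp⟩ := hper
      exact Function.IsPeriodicPt.minimalPeriod_pos hj hjp
    obtain ⟨k, hk⟩ := Nat.exists_eq_succ_of_ne_zero hpos.ne'
    have hper' : Function.IsPeriodicPt (eapp (g a)) (k+1) p := by
      have := Function.isPeriodicPt_minimalPeriod (eapp (g a)) p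
      rwa [show Function.minimalPeriod (eapp (g a)) p = k + 1 from hk] at this
    let x : Fin (k+1) → Cn n := fun i => (eapp (g a))^[i] p
    have hx : Injective x := by
      intro i j hij
      apply Fin.ext
      refine Function.iterate_injOn_Iio_minimalPeriod (f := eapp (g a)) (x := p) ?_ ?_ hij
      · show _ < minPer (g a) p
        rw [hk]; exact i.2
      · show _ < minPer (g a) p
        rw [hk]; exact j.2
    have hxn : ∀ j : ℕ, x (Fin.ofNat (k+1) j) = (eapp (g a))^[j] p := fun j =>
      hper'.iterate_mod_apply j
    let k' : Fin m := ⟨k, by omega⟩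
    have hxc := hcov k' hx
    simp only [Set.mem_iUnion] at hxc
    obtain ⟨y, hy, hxy⟩ := hxc
    have hga := Set.mem_iInter₂.1 (Set.mem_iInter.1 ha k') y hy
    refine hga x hxy ?_ ?_
    · intro i
      show eapp (g a) (x i) = x (i+1)
      have : x (i+1) = (eapp (g a))^[(i:ℕ)+1] p := by
        rw [← hxn]
        congr 1
        apply Fin.ext
        simp [Fin.val_add, Fin.ofNat, k']
      rw [this, Function.iterate_succ_apply']
    · refine ⟨z, ?_, hz1⟩
      have hz' : z ∈ spectrum ℂ (fderiv ℂ ((eapp (g a))^[minPer (g a) p]) p) := hz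
      rw [hk, aux_fderiv_iter (g := eapp (g a)) (g a).2] at hz'
      convert hz' using 3
      funext j
      show fderiv ℂ (eapp f) (x (Fin.ofNat (k+1) j)) + fderiv ℂ (P a) (x (Fin.ofNat (k+1) j)) = _
      rw [hxn, ← fderiv_fun_add (hf _) (hPd a _)]
      rfl
  have := map_mem_closure hg (hG 0) hmem
  rwa [hg0] at this
end
end

section
/- For every n ≥ 1, every compact set K ⊆ ℂⁿ, and every m ≥ 2, the set 𝒯(m,K) ∩ ℋ(m−1,K) is dense in ℋ(m−1,K); that is, ℋ(m−1,K) is contained in the closure of 𝒯(m,K) ∩ ℋ(m−1,K) in End(ℂⁿ). (Proposition 2.3 of the paper, proved for Oka-Stein manifolds; specialized to ℂⁿ.) -/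
open Function Topology Filter Metric

noncomputable section

variable {n : ℕ}

theorem aux_contDiff_one {E E' : Type*} [NormedAddCommGroup E] [NormedSpace ℂ E]
    [FiniteDimensional ℂ E] [NormedAddCommGroup E'] [NormedSpace ℂ E'] [CompleteSpace E']
    {f : E → E'} (hf : Differentiable ℂ f) : ContDiff ℂ 1 f := by
  rw [contDiff_one_iff_fderiv]
  refine ⟨hf, continuous_clm_apply.2 fun v => ?_⟩
  have key : ∀ x, fderiv ℂ f x v = (2 * Real.pi * Complex.I : ℂ)⁻¹ •
      ∮ z in C(0, 1), ((z - 0) ^ 2)⁻¹ • f (x + z • v) := by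
    intro x
    have hd : Differentiable ℂ (fun z : ℂ => f (x + z • v)) := by fun_prop
    have h1 := Complex.two_pi_I_inv_smul_circleIntegral_sub_sq_inv_smul_of_differentiable
      (U := Set.univ) isOpen_univ (c := 0) (w₀ := 0) (R := 1) (by simp)
      hd.differentiableOn (by simp)
    rw [h1]
    have h2 : HasFDerivAt f (fderiv ℂ f x) (x + (0:ℂ) • v) := by
      simpa using (hf x).hasFDerivAt
    have h3 : HasDerivAt (fun z : ℂ => x + z • v) v 0 := by
      simpa using ((hasDerivAt_id (0:ℂ)).smul_const v).const_add x
    exact (h2.comp_hasDerivAt (0:ℂ) h3).deriv.symm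
  simp_rw [key]
  refine Continuous.const_smul ?_ _
  unfold circleIntegral
  apply intervalIntegral.continuous_parametric_intervalIntegral_of_continuous'
  have hc := hf.continuous
  have hne : ∀ θ : ℝ, (circleMap 0 1 θ - 0) ^ 2 ≠ 0 := by
    intro θ; simp
  have hcm : Continuous (circleMap 0 1) := continuous_circleMap 0 1
  have hinv : Continuous fun θ : ℝ => ((circleMap 0 1 θ - 0) ^ 2)⁻¹ :=
    ((hcm.sub continuous_const).pow 2).inv₀ hne
  simp only [deriv_circleMap]
  unfold Function.uncurry
  dsimp only
  have e1 : Continuous fun a : E × ℝ => circleMap 0 1 a.2 * Complex.I := by fun_prop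
  exact e1.smul ((hinv.comp continuous_snd).smul (hc.comp (by fun_prop)))

theorem aux_isUnit {E : Type*} [NormedAddCommGroup E] [NormedSpace ℂ E]
    [FiniteDimensional ℂ E] (A : E →L[ℂ] E) (h : ¬ IsUnit A) : ∃ v, v ≠ 0 ∧ A v = 0 := by
  by_contra! hc
  apply h
  have hinj : Function.Injective (A : E →ₗ[ℂ] E) := by
    rw [injective_iff_map_eq_zero]
    intro v hv
    by_contra h0
    exact hc v h0 hv
  let e : E ≃L[ℂ] E := (LinearEquiv.ofInjectiveEndo _ hinj).toContinuousLinearEquiv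
  have : A = (e : E →L[ℂ] E) := by ext x; rfl
  rw [this]
  exact (ContinuousLinearEquiv.unitsEquiv ℂ E).symm e |>.isUnit

theorem aux_sard {E : Type*} [NormedAddCommGroup E] [NormedSpace ℂ E]
    [FiniteDimensional ℂ E] {F : E × E → E} (hF : ContDiff ℂ 1 F) {ε : ℝ} (hε : 0 < ε)
    {A : Set E}
    (hA : ∀ t ∈ ball (0 : E) ε, ∀ x ∈ A,
      ‖(fderiv ℂ F (t, x)).comp (ContinuousLinearMap.inl ℂ E E) - ContinuousLinearMap.id ℂ E‖
        ≤ 1 / 2) :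
    ∃ t ∈ ball (0 : E) ε, ∀ x ∈ A, F (t, x) = 0 →
      IsUnit ((fderiv ℂ F (t, x)).comp (ContinuousLinearMap.inr ℂ E E)) := by
  classical
  have hFd : Differentiable ℂ F := hF.differentiable (by simp)
  by_contra! hbad
  -- the Lipschitz estimate
  have hlip : ∀ t ∈ ball (0 : E) ε, ∀ t' ∈ ball (0 : E) ε, ∀ x ∈ A,
      ‖t' - t‖ ≤ 2 * ‖F (t', x) - F (t, x)‖ := by
    intro t ht t' ht' x hx
    have h1 : ∀ u ∈ ball (0 : E) ε, HasFDerivWithinAt (fun u => F (u, x) - u)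
        ((fderiv ℂ F (u, x)).comp (ContinuousLinearMap.inl ℂ E E) - ContinuousLinearMap.id ℂ E)
        (ball 0 ε) u := by
      intro u hu
      have h2 : HasFDerivAt (fun u : E => (u, x)) (ContinuousLinearMap.inl ℂ E E) u :=
        hasFDerivAt_prodMk_left u x
      exact (((hFd (u, x)).hasFDerivAt.comp u h2).sub (hasFDerivAt_id u)).hasFDerivWithinAt
    have h3 := (convex_ball (0 : E) ε).norm_image_sub_le_of_norm_hasFDerivWithin_le (𝕜 := ℂ)
      h1 (fun u hu => hA u hu x hx) ht ht'
    have h4 : t' - t = (F (t', x) - F (t, x)) - ((F (t', x) - t') - (F (t, x) - t)) := by abel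
    have h5 : ‖t' - t‖ ≤ ‖F (t', x) - F (t, x)‖ + ‖(F (t', x) - t') - (F (t, x) - t)‖ := by
      conv_lhs => rw [h4]
      exact norm_sub_le _ _
    linarith
  have hinjt : ∀ t ∈ ball (0 : E) ε, ∀ x ∈ A, ∀ v : E, fderiv ℂ F (t, x) (v, 0) = 0 → v = 0 := by
    intro t ht x hx v hv
    have h1 := ((fderiv ℂ F (t, x)).comp (ContinuousLinearMap.inl ℂ E E) -
      ContinuousLinearMap.id ℂ E).le_of_opNorm_le (hA t ht x hx) v
    simp [hv] at h1
    have : ‖v‖ ≤ 0 := by linarith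
    simpa using this
  -- bad set of points
  let s : Set E := {x | x ∈ A ∧ ∃ t ∈ ball (0 : E) ε, F (t, x) = 0 ∧
    ¬ IsUnit ((fderiv ℂ F (t, x)).comp (ContinuousLinearMap.inr ℂ E E))}
  have hs : ∀ x, ∃ t, x ∈ s → (t ∈ ball (0 : E) ε ∧ F (t, x) = 0 ∧
    ¬ IsUnit ((fderiv ℂ F (t, x)).comp (ContinuousLinearMap.inr ℂ E E))) := by
    intro x
    by_cases hx : x ∈ s
    · obtain ⟨_, t, ht⟩ := hx
      exact ⟨t, fun _ => ht⟩
    · exact ⟨0, fun h => absurd h hx⟩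
  choose τ hτ using hs
  have hsub : ball (0 : E) ε ⊆ τ '' s := by
    intro t ht
    obtain ⟨x, hx, h0, hu⟩ := hbad t ht
    have hxs : x ∈ s := ⟨hx, t, ht, h0, hu⟩
    refine ⟨x, hxs, ?_⟩
    obtain ⟨h1, h2, h3⟩ := hτ x hxs
    have := hlip t ht (τ x) h1 x hx
    rw [h2, h0] at this
    simp at this
    exact sub_eq_zero.1 this
  have hcont : ∀ x ∈ s, Tendsto τ (𝓝[s] x) (𝓝 (τ x)) := by
    intro x hx
    rw [tendsto_iff_norm_sub_tendsto_zero]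
    have h1 : Tendsto (fun y => 2 * ‖F (τ x, y)‖) (𝓝[s] x) (𝓝 0) := by
      have : Continuous fun y => 2 * ‖F (τ x, y)‖ := by
        have := hF.continuous
        fun_prop
      have h2 := (this.tendsto x).mono_left (nhdsWithin_le_nhds (s := s))
      rwa [(hτ x hx).2.1, norm_zero, mul_zero] at h2
    refine squeeze_zero' (Eventually.of_forall fun _ => norm_nonneg _) ?_ h1
    filter_upwards [self_mem_nhdsWithin] with y hy
    have := hlip (τ x) (hτ x hx).1 (τ y) (hτ y hy).1 y hy.1
    rwa [(hτ y hy).2.1, zero_sub, norm_neg] at this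
  have hder : ∀ x, ∃ T : E →L[ℂ] E, x ∈ s → HasFDerivWithinAt τ T s x ∧ ∃ v, v ≠ 0 ∧ T v = 0 := by
    intro x
    by_cases hx : x ∈ s
    swap
    · exact ⟨0, fun h => absurd h hx⟩
    obtain ⟨h1, h2, h3⟩ := hτ x hx
    let M : (E × E) →L[ℂ] (E × E) := (fderiv ℂ F (τ x, x)).prod (ContinuousLinearMap.snd ℂ E E)
    have hMinj : Function.Injective (M : (E × E) →ₗ[ℂ] (E × E)) := by
      rw [injective_iff_map_eq_zero]
      rintro ⟨a, b⟩ hab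
      have hb : b = 0 := congrArg Prod.snd hab
      subst hb
      have ha : fderiv ℂ F (τ x, x) (a, 0) = 0 := congrArg Prod.fst hab
      rw [hinjt _ h1 x hx.1 a ha]; rfl
    let e : (E × E) ≃L[ℂ] (E × E) := (LinearEquiv.ofInjectiveEndo _ hMinj).toContinuousLinearEquiv
    have heM : (e : (E × E) →L[ℂ] (E × E)) = M := by ext <;> rfl
    let s' : Set (E × E) := {p | p.1 = 0 ∧ p.2 ∈ s}
    have hg : HasFDerivWithinAt (fun p : E × E => (τ p.2, p.2))
        (e.symm : (E × E) →L[ℂ] (E × E)) s' (0, x) := by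
      refine HasFDerivWithinAt.of_local_left_inverse (t := Set.univ)
        (f := fun p : E × E => (F p, p.2)) ?_ ?_ ⟨rfl, hx⟩ ?_
      · rw [nhdsWithin_univ]
        have hsnd : Tendsto (Prod.snd : E × E → E) (𝓝[s'] (0, x)) (𝓝[s] x) :=
          tendsto_nhdsWithin_of_tendsto_nhds_of_eventually_within _
            ((continuous_snd.tendsto ((0 : E), x)).mono_left nhdsWithin_le_nhds)
            (by filter_upwards [self_mem_nhdsWithin] with p hp using hp.2)
        exact ((hcont x hx).comp hsnd).prodMk_nhds (hsnd.mono_right nhdsWithin_le_nhds)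
      · rw [heM]
        exact ((hFd (τ x, x)).hasFDerivAt.prodMk hasFDerivAt_snd).hasFDerivWithinAt
      · filter_upwards [self_mem_nhdsWithin] with p hp
        ext1
        · simp only [(hτ p.2 hp.2).2.1, hp.1]
        · rfl
    refine ⟨(ContinuousLinearMap.fst ℂ E E).comp
      ((e.symm : (E × E) →L[ℂ] (E × E)).comp (ContinuousLinearMap.inr ℂ E E)), fun _ => ⟨?_, ?_⟩⟩
    · have h5 : HasFDerivWithinAt (fun y : E => ((0 : E), y)) (ContinuousLinearMap.inr ℂ E E) s x :=
        (hasFDerivAt_prodMk_right (0 : E) x).hasFDerivWithinAt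
      have h6 := hg.comp x h5 (fun y hy => ⟨rfl, hy⟩)
      exact (ContinuousLinearMap.fst ℂ E E).hasFDerivAt.comp_hasFDerivWithinAt x h6
    · obtain ⟨v, hv0, hv⟩ := aux_isUnit _ h3
      refine ⟨v, hv0, ?_⟩
      have : e (0, v) = (0, v) := by
        have h7 : e (0, v) = M (0, v) := by rw [← heM]; rfl
        rw [h7]
        ext1
        · exact hv
        · rfl
      have h8 : e.symm (0, v) = (0, v) := by
        rw [ContinuousLinearEquiv.symm_apply_eq, this]
      simp [h8]
  choose T hT using hder
  let _ : MeasurableSpace E := borel E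
  have : BorelSpace E := ⟨rfl⟩
  have : FiniteDimensional ℝ E := FiniteDimensional.complexToReal E
  have hnull := MeasureTheory.addHaar_image_eq_zero_of_det_fderivWithin_eq_zero
    (MeasureTheory.Measure.addHaar : MeasureTheory.Measure E) (f := τ) (s := s)
    (f' := fun x => (T x).restrictScalars ℝ) (fun x hx => (hT x hx).1.restrictScalars ℝ) (by
      intro x hx
      obtain ⟨v, hv0, hv⟩ := (hT x hx).2
      by_contra hdet
      have hu : IsUnit (LinearMap.det (((T x).restrictScalars ℝ : E →L[ℝ] E) : E →ₗ[ℝ] E)) :=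
        isUnit_iff_ne_zero.2 hdet
      have := (LinearEquiv.ofIsUnitDet (v := Module.finBasis ℝ E) (v' := Module.finBasis ℝ E)
        (f := (((T x).restrictScalars ℝ : E →L[ℝ] E) : E →ₗ[ℝ] E))
        (by rwa [LinearMap.det_toMatrix])).injective
      exact hv0 (this (by simpa using hv)))
  have h9 := MeasureTheory.measure_mono_null hsub hnull
  exact (measure_ball_pos _ _ hε).ne' h9

theorem aux_neg {R : Type*} [Ring R] {a b : R} (h : IsUnit (a - b)) : IsUnit (b - a) := by
  rw [← neg_sub]
  exact h.neg

theorem aux_open {X Y E : Type*} [TopologicalSpace X] [TopologicalSpace Y]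
    [NormedAddCommGroup E] [NormedSpace ℂ E] [FiniteDimensional ℂ E]
    {F : X × Y → E} (hF : Continuous F) {D : X × Y → (E →L[ℂ] E)} (hD : Continuous D)
    {A : Set Y} (hA : IsCompact A) {s : X}
    (h : ∀ x ∈ A, F (s, x) = 0 → IsUnit (D (s, x))) :
    ∀ᶠ s' in 𝓝 s, ∀ x ∈ A, F (s', x) = 0 → IsUnit (D (s', x)) := by
  have : CompleteSpace E := FiniteDimensional.complete ℂ E
  apply hA.eventually_forall_of_forall_eventually
  intro x hx
  by_cases h0 : F (s, x) = 0
  · have hu := h x hx h0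
    have : ∀ᶠ z in 𝓝 (s, x), D z ∈ {a : E →L[ℂ] E | IsUnit a} :=
      (hD.tendsto (s, x)).eventually (Units.isOpen.mem_nhds hu)
    exact this.mono fun z hz _ => hz
  · exact ((hF.tendsto (s, x)).eventually_ne h0).mono fun z hz h => absurd h hz

theorem aux_core {ι E : Type*} [Fintype ι] [DecidableEq ι] [NormedAddCommGroup E] [NormedSpace ℂ E]
    [FiniteDimensional ℂ E] {F : (ι → E) × E → E} (hF : ContDiff ℂ 1 F) {A : ι → Set E}
    (hA : ∀ j, IsCompact (A j))
    (h0 : ∀ j, ∀ x ∈ A j, ‖(fderiv ℂ F (0, x)).comp ((ContinuousLinearMap.inl ℂ (ι → E) E).comp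
      (ContinuousLinearMap.single ℂ (fun _ : ι => E) j)) - ContinuousLinearMap.id ℂ E‖ < 1 / 2)
    {V : Set (ι → E)} (hV : V ∈ 𝓝 0) :
    ∃ s ∈ V, ∀ j, ∀ x ∈ A j, F (s, x) = 0 →
      IsUnit ((fderiv ℂ F (s, x)).comp (ContinuousLinearMap.inr ℂ (ι → E) E)) := by
  have hFd : Differentiable ℂ F := hF.differentiable (by simp)
  have hFc : Continuous (fderiv ℂ F) := hF.continuous_fderiv (by simp)
  have hB : ∀ᶠ s in 𝓝 (0 : ι → E), ∀ j, ∀ x ∈ A j,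
      ‖(fderiv ℂ F (s, x)).comp ((ContinuousLinearMap.inl ℂ (ι → E) E).comp
      (ContinuousLinearMap.single ℂ (fun _ : ι => E) j)) - ContinuousLinearMap.id ℂ E‖ < 1 / 2 := by
    rw [eventually_all]
    intro j
    apply (hA j).eventually_forall_of_forall_eventually
    intro x hx
    have hc : Continuous fun z : (ι → E) × E =>
      ‖(fderiv ℂ F z).comp ((ContinuousLinearMap.inl ℂ (ι → E) E).comp
      (ContinuousLinearMap.single ℂ (fun _ : ι => E) j)) - ContinuousLinearMap.id ℂ E‖ :=
      ((hFc.clm_comp continuous_const).sub continuous_const).norm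
    exact (hc.tendsto (0, x)).eventually_lt_const (h0 j x hx)
  obtain ⟨O, hO, hOo, h0O⟩ := _root_.mem_nhds_iff.1 (inter_mem hB hV)
  have main : ∀ T : Finset ι, ∃ W : Set (ι → E), IsOpen W ∧ W.Nonempty ∧ W ⊆ O ∧
      ∀ s ∈ W, ∀ j ∈ T, ∀ x ∈ A j, F (s, x) = 0 →
      IsUnit ((fderiv ℂ F (s, x)).comp (ContinuousLinearMap.inr ℂ (ι → E) E)) := by
    intro T
    induction T using Finset.induction_on with
    | empty => exact ⟨O, hOo, ⟨0, h0O⟩, subset_rfl, by simp⟩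
    | insert j T hj ih =>
      obtain ⟨W, hWo, ⟨s, hs⟩, hWO, hW⟩ := ih
      obtain ⟨ε, hε, hball⟩ := Metric.isOpen_iff.1 hWo s hs
      have hmem : ∀ t ∈ ball (0 : E) ε, s + Pi.single j t ∈ W := by
        intro t ht
        apply hball
        rw [mem_ball, dist_eq_norm, add_sub_cancel_left, Pi.norm_single]
        simpa using ht
      let a : E × E →L[ℂ] (ι → E) × E :=
        (ContinuousLinearMap.single ℂ (fun _ : ι => E) j).prodMap (ContinuousLinearMap.id ℂ E)
      have hpt : ∀ t x, ((s, 0) : (ι → E) × E) + a (t, x) = (s + Pi.single j t, x) := by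
        intro t x
        ext1
        · rfl
        · exact zero_add x
      let F' : E × E → E := fun q => F ((s, 0) + a q)
      have hF' : ContDiff ℂ 1 F' := hF.comp (contDiff_const.add a.contDiff)
      have hder : ∀ t x, fderiv ℂ F' (t, x) = (fderiv ℂ F (s + Pi.single j t, x)).comp a := by
        intro t x
        have h1 : HasFDerivAt (fun q => ((s, 0) : (ι → E) × E) + a q) a (t, x) :=
          a.hasFDerivAt.const_add _
        have h2 := (hFd ((s, 0) + a (t, x))).hasFDerivAt
        have h3 := (h2.comp (t, x) h1).fderiv
        rw [hpt] at h3
        exact h3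
      obtain ⟨t, ht, hgood⟩ := aux_sard hF' hε (A := A j) (by
        intro t ht x hx
        have := (hO (hWO (hmem t ht))).1 j x hx
        rw [hder]
        refine le_trans (le_of_eq ?_) this.le
        congr 2)
      have hgood' : ∀ x ∈ A j, F (s + Pi.single j t, x) = 0 →
          IsUnit ((fderiv ℂ F (s + Pi.single j t, x)).comp
            (ContinuousLinearMap.inr ℂ (ι → E) E)) := by
        intro x hx hx0
        have := hgood x hx (by simpa only [F', hpt] using hx0)
        rw [hder] at this
        convert this using 1
        ext v
        simp [a]
      have hev := aux_open (D := fun z => (fderiv ℂ F z).comp (ContinuousLinearMap.inr ℂ (ι → E) E))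
        hF.continuous (hFc.clm_comp continuous_const) (hA j) hgood'
      obtain ⟨W', hW', hW'o, hmW'⟩ := _root_.mem_nhds_iff.1 (inter_mem hev (hWo.mem_nhds (hmem t ht)))
      refine ⟨W', hW'o, ⟨_, hmW'⟩, fun z hz => hWO (hW' hz).2, ?_⟩
      intro z hz i hi
      rcases Finset.mem_insert.1 hi with rfl | hi
      · exact (hW' hz).1
      · exact hW z (hW' hz).2 i hi
  obtain ⟨W, _, ⟨s, hs⟩, hWO, hW⟩ := main Finset.univ
  exact ⟨s, (hO (hWO hs)).2, fun j => hW s hs j (Finset.mem_univ j)⟩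

theorem aux_iter {P E : Type*} [NormedAddCommGroup E] [NormedSpace ℂ E]
    [NormedAddCommGroup P] [NormedSpace ℂ P] {Φ : P × E → E} (h : ContDiff ℂ 1 Φ) (k : ℕ) :
    ContDiff ℂ 1 fun z : P × E => (fun y => Φ (z.1, y))^[k] z.2 := by
  induction k with
  | zero => exact contDiff_snd
  | succ k ih =>
    simp only [Function.iterate_succ_apply']
    exact h.comp (contDiff_fst.prodMk ih)

theorem aux_interp_s3 {E : Type*} [NormedAddCommGroup E] [NormedSpace ℂ E]
    [FiniteDimensional ℂ E] (b : ℕ → E) (k : ℕ) (a : E) (hab : ∀ i < k, b i ≠ a) :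
    ∃ h : E → ℂ, Differentiable ℂ h ∧ h a = 1 ∧ ∀ i < k, h (b i) = 0 := by
  induction k with
  | zero => exact ⟨fun _ => 1, differentiable_const _, rfl, by simp⟩
  | succ k ih =>
    obtain ⟨h, hd, ha, hb⟩ := ih fun i hi => hab i (by omega)
    obtain ⟨φ, hφ⟩ := SeparatingDual.exists_ne_zero (R := ℂ)
      (sub_ne_zero.2 (hab k (by omega)).symm)
    refine ⟨fun x => h x * (φ (x - b k) / φ (a - b k)), ?_, ?_, ?_⟩
    · fun_prop
    · simp only [ha, div_self hφ, mul_one]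
    · intro i hi
      rcases Nat.lt_succ_iff_lt_or_eq.1 hi with hi | rfl
      · simp [hb i hi]
      · simp

theorem aux_pder {E : Type*} [NormedAddCommGroup E] [NormedSpace ℂ E]
    {f : E → E} (hf : Differentiable ℂ f) {h : E → ℂ} (hh : Differentiable ℂ h) (p : E) (k : ℕ)
    (hz : ∀ i < k, h (f^[i] p) = 0) :
    HasFDerivAt (fun t : E => (fun y => f y + h y • t)^[k] p) (0 : E →L[ℂ] E) 0 := by
  induction k with
  | zero => exact hasFDerivAt_const p 0
  | succ k ih =>
    have ih := ih fun i hi => hz i (by omega)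
    have e : (fun y => f y + h y • (0:E))^[k] p = f^[k] p := by simp
    have h1 := ((hf _).hasFDerivAt.comp (0:E) ih).add
      (((hh _).hasFDerivAt.comp (0:E) ih).smul (hasFDerivAt_id (0:E)))
    simp only [Function.iterate_succ_apply']
    refine h1.congr_fderiv ?_
    ext v
    simp [hz k (by omega)]

theorem aux_pder' {E : Type*} [NormedAddCommGroup E] [NormedSpace ℂ E]
    {f : E → E} (hf : Differentiable ℂ f) {h : E → ℂ} (hh : Differentiable ℂ h) (p : E) (k : ℕ)
    (hz : ∀ i < k, h (f^[i] p) = 0) (h1 : h (f^[k] p) = 1) :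
    HasFDerivAt (fun t : E => (fun y => f y + h y • t)^[k+1] p) (ContinuousLinearMap.id ℂ E) 0 := by
  have ih := aux_pder hf hh p k hz
  have h2 := ((hf _).hasFDerivAt.comp (0:E) ih).add
      (((hh _).hasFDerivAt.comp (0:E) ih).smul (hasFDerivAt_id (0:E)))
  simp only [Function.iterate_succ_apply']
  refine h2.congr_fderiv ?_
  ext v
  simp [h1]

theorem aux_local_s3 {E : Type*} [NormedAddCommGroup E] [NormedSpace ℂ E] [FiniteDimensional ℂ E]
    {f : E → E} (hf : Differentiable ℂ f) (p : E) (m : ℕ) (hm : 2 ≤ m)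
    (hp : Function.minimalPeriod f p = m) :
    ∃ h : E → ℂ, Differentiable ℂ h ∧ ∃ U C : Set E, IsOpen U ∧ IsClosed C ∧ p ∈ U ∧ U ⊆ C ∧
      ∀ x ∈ C, ‖fderiv ℂ (fun t : E => (fun y => f y + h y • t)^[m] x) 0
        - ContinuousLinearMap.id ℂ E‖ < 1 / 2 := by
  have : CompleteSpace E := FiniteDimensional.complete ℂ E
  obtain ⟨k, rfl⟩ : ∃ k, m = k + 1 := ⟨m - 1, by omega⟩
  obtain ⟨h, hh, h1, hz⟩ := aux_interp_s3 (fun i => f^[i] p) k (f^[k] p) (by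
    intro i hi heq
    have := Function.iterate_injOn_Iio_minimalPeriod (f := f) (x := p)
      (x₁ := i) (x₂ := k) (by simp [hp]; omega) (by simp [hp]) heq
    omega)
  have hΦ : ContDiff ℂ 1 fun z : E × E => f z.2 + h z.2 • z.1 := by
    have a1 := aux_contDiff_one hf
    have a2 := aux_contDiff_one hh
    fun_prop
  have hG := aux_iter hΦ (k + 1)
  have hGc := hG.continuous_fderiv (by simp)
  have hGd := hG.differentiable (by simp)
  have hder : ∀ x, fderiv ℂ (fun t : E => (fun y => f y + h y • t)^[k + 1] x) 0 =
      (fderiv ℂ (fun z : E × E => (fun y => f y + h y • z.1)^[k + 1] z.2) (0, x)).comp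
        (ContinuousLinearMap.inl ℂ E E) := by
    intro x
    have b1 := (hGd (0, x)).hasFDerivAt
    have b2 := hasFDerivAt_prodMk_left (𝕜 := ℂ) (0 : E) x
    exact (b1.comp (0 : E) b2).fderiv
  let N : E → ℝ := fun x => ‖fderiv ℂ (fun t : E => (fun y => f y + h y • t)^[k + 1] x) 0
        - ContinuousLinearMap.id ℂ E‖
  have hN : Continuous N := by
    simp only [N, hder]
    exact (((hGc.comp (continuous_const.prodMk continuous_id)).clm_comp
      continuous_const).sub continuous_const).norm
  refine ⟨h, hh, {x | N x < 1 / 4}, {x | N x ≤ 1 / 4}, isOpen_lt hN continuous_const,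
    isClosed_le hN continuous_const, ?_, fun x (hx : N x < 1 / 4) => hx.le, ?_⟩
  · have := (aux_pder' hf hh p k hz h1).fderiv
    simp only [N, Set.mem_ofPred_eq, this]
    simp
  · intro x hx
    have hx : N x ≤ 1 / 4 := hx
    have : N x < 1 / 2 := by linarith
    exact this

theorem aux_hyp {n : ℕ} {f : Endo n} {K : Set (Cn n)} {m : ℕ} (hf : f ∈ HypSet n (m - 1) K)
    {x : Cn n} (hx : x ∈ K) {k : ℕ} (hk : 1 ≤ k) (hfix : (eapp f)^[k] x = x)
    (hlt : minPer f x ≤ m - 1) {z : ℂ} (hz : ‖z‖ = 1) :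
    IsUnit (fderiv ℂ ((eapp f)^[k]) x - algebraMap ℂ (Cn n →L[ℂ] Cn n) z) := by
  have hdiff : Differentiable ℂ (eapp f) := f.2
  refine aux_neg ?_
  have hp : Function.IsPeriodicPt (eapp f) k x := hfix
  obtain ⟨j, hj⟩ := hp.minimalPeriod_dvd
  have hd : (eapp f)^[minPer f x] x = x := Function.iterate_minimalPeriod
  have hj0 : 0 < j := by
    rcases Nat.eq_zero_or_pos j with h | h
    · subst h; omega
    · exact h
  have hD : fderiv ℂ ((eapp f)^[k]) x = (fderiv ℂ ((eapp f)^[minPer f x]) x) ^ j := by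
    have h1 := (hdiff.iterate (minPer f x) x).hasFDerivAt.iterate hd j
    rw [← Function.iterate_mul] at h1
    rw [hj]
    exact h1.fderiv
  by_contra hc
  have hmem : z ∈ spectrum ℂ (fderiv ℂ ((eapp f)^[k]) x) := hc
  rw [hD, spectrum.map_pow_of_pos _ hj0] at hmem
  obtain ⟨w, hw, rfl⟩ := hmem
  refine hf x hx ⟨k, hk, hfix⟩ hlt w hw ?_
  simp only [norm_pow] at hz
  exact (pow_eq_one_iff_of_nonneg (norm_nonneg w) hj0.ne').1 hz

/-- `𝒯(m,K) ∩ ℋ(m−1,K)` is dense in `ℋ(m−1,K)` for `m ≥ 2`. -/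
theorem stmt_3 (n : ℕ) (hn : 1 ≤ n) (K : Set (Cn n)) (hK : IsCompact K) (m : ℕ) (hm : 2 ≤ m) :
    HypSet n (m - 1) K ⊆ closure (TransSet n m K ∩ HypSet n (m - 1) K) := by
  classical
  intro f hf
  have hdiff : Differentiable ℂ (eapp f) := f.2
  have hdiffm : ContDiff ℂ 1 ((eapp f)^[m]) := aux_contDiff_one (hdiff.iterate m)
  let R : Set (Cn n) := {x | x ∈ K ∧ (eapp f)^[m] x = x ∧
    ¬ IsUnit (fderiv ℂ ((eapp f)^[m]) x - algebraMap ℂ (Cn n →L[ℂ] Cn n) 1)}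
  have hRc : IsCompact R := by
    refine hK.inter_right (t := {x | (eapp f)^[m] x = x ∧
      ¬ IsUnit (fderiv ℂ ((eapp f)^[m]) x - algebraMap ℂ (Cn n →L[ℂ] Cn n) 1)}) ?_
    refine (isClosed_eq hdiffm.continuous continuous_id).inter ?_
    have hc : Continuous fun x => fderiv ℂ ((eapp f)^[m]) x - algebraMap ℂ (Cn n →L[ℂ] Cn n) 1 :=
      (hdiffm.continuous_fderiv (by simp)).sub continuous_const
    exact (Units.isOpen.preimage hc).isClosed_compl
  have hRm : ∀ p ∈ R, Function.minimalPeriod (eapp f) p = m := by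
    rintro p ⟨hp, hfix, hnu⟩
    by_contra hne
    have hper : Function.IsPeriodicPt (eapp f) m p := hfix
    have hle := hper.minimalPeriod_le (by omega)
    refine hnu (aux_hyp hf hp (by omega) hfix ?_ (by simp))
    unfold minPer
    omega
  choose! h hh U C hU hC hpU hUC hest using fun p (hp : p ∈ R) =>
    aux_local_s3 hdiff p m hm (hRm p hp)
  obtain ⟨T, hTR, hT⟩ := hRc.elim_nhds_subcover U fun p hp => (hU p hp).mem_nhds (hpU p hp)
  -- the family
  let Φ : (T → Cn n) × Cn n → Cn n := fun z => eapp f z.2 + ∑ j : T, h j z.2 • z.1 j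
  have hhd : ∀ j : T, ContDiff ℂ 1 (h j) := fun j => aux_contDiff_one (hh j (hTR j j.2))
  have hΦ : ContDiff ℂ 1 Φ := by
    have a1 := aux_contDiff_one hdiff
    refine (a1.comp contDiff_snd).add (ContDiff.sum fun j _ => ?_)
    refine ((hhd j).comp contDiff_snd).smul ?_
    exact (contDiff_apply ℂ (Cn n) j).comp contDiff_fst
  let G : ℕ → (T → Cn n) × Cn n → Cn n := fun k z => (fun y => Φ (z.1, y))^[k] z.2
  have hG : ∀ k, ContDiff ℂ 1 (G k) := fun k => aux_iter hΦ k
  have hGd : ∀ k, Differentiable ℂ (G k) := fun k => (hG k).differentiable (by simp)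
  have hGx : ∀ k s x, (fderiv ℂ (G k) (s, x)).comp (ContinuousLinearMap.inr ℂ (T → Cn n) (Cn n)) =
      fderiv ℂ ((fun y => Φ (s, y))^[k]) x := by
    intro k s x
    have b1 := (hGd k (s, x)).hasFDerivAt
    have b2 := hasFDerivAt_prodMk_right (𝕜 := ℂ) s x
    exact (b1.comp x b2).fderiv.symm
  have hΦ0 : (fun y => Φ (0, y)) = eapp f := by
    funext y
    simp [Φ]
  let g : (T → Cn n) → Endo n := fun s => ⟨⟨fun y => Φ (s, y),
    hΦ.continuous.comp (continuous_const.prodMk continuous_id)⟩,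
    (hΦ.differentiable (by simp)).comp ((differentiable_const s).prodMk differentiable_id)⟩
  have hg0 : g 0 = f := by
    apply Subtype.ext
    apply ContinuousMap.ext
    exact congrFun hΦ0
  have hgc : Continuous g := by
    refine Continuous.subtype_mk ?_ _
    exact ContinuousMap.continuous_of_continuous_uncurry _ hΦ.continuous
  -- hyperbolicity is preserved
  have hev1 : ∀ k ∈ Finset.Icc 1 (m - 1), ∀ᶠ s in 𝓝 (0 : T → Cn n),
      ∀ q ∈ K ×ˢ sphere (0 : ℂ) 1, G k (s, q.1) - q.1 = 0 →
        IsUnit ((fderiv ℂ (G k) (s, q.1)).comp (ContinuousLinearMap.inr ℂ (T → Cn n) (Cn n))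
          - algebraMap ℂ (Cn n →L[ℂ] Cn n) q.2) := by
    intro k hk
    rw [Finset.mem_Icc] at hk
    have hFc := (hG k).continuous_fderiv (by simp)
    have hp : Continuous fun z : (T → Cn n) × (Cn n × ℂ) => (z.1, z.2.1) := by fun_prop
    refine aux_open (F := fun z : (T → Cn n) × (Cn n × ℂ) => G k (z.1, z.2.1) - z.2.1)
      (D := fun z : (T → Cn n) × (Cn n × ℂ) =>
        (fderiv ℂ (G k) (z.1, z.2.1)).comp (ContinuousLinearMap.inr ℂ (T → Cn n) (Cn n))
          - algebraMap ℂ (Cn n →L[ℂ] Cn n) z.2.2)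
      (((hG k).continuous.comp hp).sub (by fun_prop))
      (((hFc.comp hp).clm_comp continuous_const).sub
        ((continuous_algebraMap ℂ (Cn n →L[ℂ] Cn n)).comp (by fun_prop)))
      (hK.prod (isCompact_sphere 0 1)) ?_
    rintro ⟨x, z⟩ ⟨hx, hz⟩ h0
    have hfix : (eapp f)^[k] x = x := by
      have := sub_eq_zero.1 h0
      simpa only [G, hΦ0] using this
    dsimp only
    rw [hGx, hΦ0]
    have hper : Function.IsPeriodicPt (eapp f) k x := hfix
    have hle := hper.minimalPeriod_le (by omega)
    exact aux_hyp hf hx hk.1 hfix (le_trans hle hk.2) (by simpa using hz)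
  -- transversality away from `R` is preserved
  have hev2 : ∀ᶠ s in 𝓝 (0 : T → Cn n), ∀ x ∈ K \ ⋃ p ∈ T, U p, G m (s, x) - x = 0 →
        IsUnit ((fderiv ℂ (G m) (s, x)).comp (ContinuousLinearMap.inr ℂ (T → Cn n) (Cn n))
          - algebraMap ℂ (Cn n →L[ℂ] Cn n) 1) := by
    refine aux_open (F := fun z : (T → Cn n) × Cn n => G m z - z.2)
      (D := fun z : (T → Cn n) × Cn n =>
        (fderiv ℂ (G m) z).comp (ContinuousLinearMap.inr ℂ (T → Cn n) (Cn n))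
          - algebraMap ℂ (Cn n →L[ℂ] Cn n) 1)
      ((hG m).continuous.sub continuous_snd)
      ((((hG m).continuous_fderiv (by simp)).clm_comp continuous_const).sub continuous_const)
      (hK.diff (isOpen_biUnion fun p hp => hU p (hTR p hp))) ?_
    rintro x ⟨hx, hxU⟩ h0
    have hfix : (eapp f)^[m] x = x := by
      have := sub_eq_zero.1 h0
      simpa only [G, hΦ0] using this
    rw [hGx, hΦ0]
    by_contra hnu
    exact hxU (hT ⟨hx, hfix, hnu⟩)
  rw [mem_closure_iff_nhds]
  intro V hV
  have hV' : g ⁻¹' V ∈ 𝓝 (0 : T → Cn n) := hgc.continuousAt.preimage_mem_nhds (by rwa [hg0])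
  have hev1' := (Finset.eventually_all (Finset.Icc 1 (m - 1))).2 hev1
  have hFm : ContDiff ℂ 1 fun z : (T → Cn n) × Cn n => G m z - z.2 := (hG m).sub contDiff_snd
  have hFmd : ∀ z, fderiv ℂ (fun z : (T → Cn n) × Cn n => G m z - z.2) z =
      fderiv ℂ (G m) z - ContinuousLinearMap.snd ℂ (T → Cn n) (Cn n) := by
    intro z
    exact ((hGd m z).hasFDerivAt.sub hasFDerivAt_snd).fderiv
  obtain ⟨s, hs, hsg⟩ := aux_core hFm (A := fun j : T => K ∩ C j)
    (fun j => hK.inter_right (hC j (hTR j j.2))) (by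
      rintro j x ⟨hx, hxC⟩
      have := hest j (hTR j j.2) x hxC
      have hsing : (fun t : Cn n => (fun y => eapp f y + h j y • t)^[m] x) =
          fun t => G m (Pi.single j t, x) := by
        funext t
        have : (fun y => eapp f y + h j y • t) = fun y => Φ (Pi.single j t, y) := by
          funext y
          simp only [Φ]
          rw [Finset.sum_eq_single j]
          · simp
          · intro i _ hi
            simp [Pi.single_eq_of_ne hi]
          · simp
        simp only [this, G]
      have hd : fderiv ℂ (fun t : Cn n => (fun y => eapp f y + h j y • t)^[m] x) 0 =
          (fderiv ℂ (G m) (0, x)).comp ((ContinuousLinearMap.inl ℂ (T → Cn n) (Cn n)).comp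
            (ContinuousLinearMap.single ℂ (fun _ : T => Cn n) j)) := by
        rw [hsing]
        have b3 := (ContinuousLinearMap.single ℂ (fun _ : T => Cn n) j).hasFDerivAt (x := 0)
        have b2 := hasFDerivAt_prodMk_left (𝕜 := ℂ)
          (ContinuousLinearMap.single ℂ (fun _ : T => Cn n) j 0) x
        have b1 := (hGd m (ContinuousLinearMap.single ℂ (fun _ : T => Cn n) j 0, x)).hasFDerivAt
        have b4 := (b1.comp (0 : Cn n) (b2.comp (0 : Cn n) b3)).fderiv
        rw [map_zero] at b4
        exact b4
      rw [hd] at this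
      rw [hFmd]
      convert this using 3
      ext v
      simp) (inter_mem hV' (inter_mem hev1' hev2))
  obtain ⟨hsV, hs1, hs2⟩ := hs
  have hyp : g s ∈ HypSet n (m - 1) K := by
    intro p hp hper hmin z hz hz1
    have hpos : 0 < minPer (g s) p := by
      obtain ⟨k, hk, hk'⟩ := hper
      exact Function.minimalPeriod_pos_of_mem_periodicPts ⟨k, hk, hk'⟩
    have hfix : (eapp (g s))^[minPer (g s) p] p = p := Function.iterate_minimalPeriod
    have := hs1 (minPer (g s) p) (Finset.mem_Icc.2 ⟨hpos, hmin⟩) (p, z)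
      ⟨hp, by simpa using hz1⟩ (sub_eq_zero.2 hfix)
    dsimp only at this
    rw [hGx] at this
    exact hz (aux_neg this)
  refine ⟨g s, hsV, ?_, hyp⟩
  intro p hp hper hmin h1
  rcases Nat.lt_or_ge (m - 1) (minPer (g s) p) with hlt | hle
  swap
  · exact hyp p hp hper hle 1 h1 (by simp)
  have hmeq : minPer (g s) p = m := by omega
  have hfix : (eapp (g s))^[minPer (g s) p] p = p := Function.iterate_minimalPeriod
  unfold eigs at h1
  rw [hmeq] at hfix h1
  have hfix' : G m (s, p) - p = 0 := sub_eq_zero.2 hfix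
  have hu : IsUnit ((fderiv ℂ (G m) (s, p)).comp (ContinuousLinearMap.inr ℂ (T → Cn n) (Cn n))
          - algebraMap ℂ (Cn n →L[ℂ] Cn n) 1) := by
    by_cases hpU : p ∈ ⋃ q ∈ T, U q
    · obtain ⟨q, hq, hpq⟩ := Set.mem_iUnion₂.1 hpU
      have := hsg ⟨q, hq⟩ p ⟨hp, hUC q (hTR q hq) hpq⟩ hfix'
      rw [hFmd] at this
      convert this using 1
      rw [map_one]
      rfl
    · exact hs2 p ⟨hp, hpU⟩ hfix'
  rw [hGx] at hu
  exact h1 (aux_neg hu)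
end
end
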